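/- arXiv:2602.07552 — 2 statements merged into one kernel-verified Lean document; each statement's English description precedes it below -/
import Mathlib

section
/- Let d ≥ 1 be an integer and let ℱ be a finite family of subsets of ℝ^d such that for every nonempty subfamily ℱ' ⊆ ℱ the intersection ⋂ℱ' is either empty, or it is path-connected and the singular homology H_i(⋂ℱ'; ℤ₂) vanishes for all 1 ≤ i ≤ d−1. Then ⋂ℱ = ∅ if and only if there exists a subfamily 𝒢 ⊆ ℱ with at most d+1 elements and ⋂𝒢 = ∅. -/
open CategoryTheory AlgebraicTopology

/-- Singular homology of a topological space with coefficients in a commutative ring `R`. -/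
noncomputable def SingularHomology (R : Type) [CommRing R]
    (X : Type) [TopologicalSpace X] (n : ℕ) : ModuleCat R :=
  (((alternatingFaceMapComplex (ModuleCat R)).obj
      (((SimplicialObject.whiskering _ _).obj (ModuleCat.free R)).obj
        (TopCat.toSSet.obj (TopCat.of X)))).homology n)

/-- Mod 2 chains on finite sequences of points of `α`. -/
abbrev ListChain (α : Type*) := List α →₀ ZMod 2

namespace ListChain

variable {α β : Type*}

/-- The sum of all sequences obtained from `l` by deleting one entry. -/
noncomputable def listBoundary (l : List α) : ListChain α :=
  ∑ i : Fin l.length, Finsupp.single (l.eraseIdx i) 1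

/-- The augmented mod 2 boundary operator on list chains. -/
noncomputable def boundary : ListChain α →ₗ[ZMod 2] ListChain α :=
  Finsupp.linearCombination (ZMod 2) listBoundary

/-- Prepending a point to every list of a chain. -/
noncomputable def cone (a : α) : ListChain α →ₗ[ZMod 2] ListChain α :=
  Finsupp.lmapDomain _ _ (List.cons a)

/-- The chain map induced by a map of points. -/
noncomputable def map (f : α → β) : ListChain α →ₗ[ZMod 2] ListChain β :=
  Finsupp.lmapDomain _ _ (List.map f)

@[simp] lemma cone_single (a : α) (l : List α) (r : ZMod 2) :
    cone a (Finsupp.single l r) = Finsupp.single (a :: l) r := by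
  simp [cone]

@[simp] lemma map_single (f : α → β) (l : List α) (r : ZMod 2) :
    map f (Finsupp.single l r) = Finsupp.single (l.map f) r := by
  simp [map]

@[simp] lemma boundary_single (l : List α) :
    boundary (Finsupp.single l 1) = listBoundary l := by
  simp [boundary]

@[simp] lemma listBoundary_nil : listBoundary ([] : List α) = 0 := by
  simp [listBoundary]

lemma listBoundary_cons (a : α) (l : List α) :
    listBoundary (a :: l) = Finsupp.single l 1 + cone a (listBoundary l) := by
  simp only [listBoundary, map_sum, cone_single]
  exact Fin.sum_univ_succ (fun i : Fin (l.length + 1) ↦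
    (Finsupp.single ((a :: l).eraseIdx i) 1 : ListChain α))

lemma boundary_cone (a : α) (c : ListChain α) :
    boundary (cone a c) = c + cone a (boundary c) := by
  have : boundary ∘ₗ cone a = LinearMap.id + cone a ∘ₗ (boundary : ListChain α →ₗ[ZMod 2] _) := by
    ext l : 2
    simp [listBoundary_cons]
  exact LinearMap.congr_fun this c

lemma boundary_listBoundary (l : List α) : boundary (listBoundary l) = 0 := by
  induction l with
  | nil => simp
  | cons a l ih =>
    simp [listBoundary_cons, boundary_cone, ih, ZModModule.add_self]

lemma map_cone (f : α → β) (a : α) (c : ListChain α) :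
    map f (cone a c) = cone (f a) (map f c) := by
  have : map f ∘ₗ cone a = cone (f a) ∘ₗ map f := by
    ext l : 2
    simp
  exact LinearMap.congr_fun this c

lemma map_listBoundary (f : α → β) (l : List α) :
    map f (listBoundary l) = listBoundary (l.map f) := by
  induction l with
  | nil => simp
  | cons a l ih => simp [listBoundary_cons, map_cone, ih]

lemma boundary_map (f : α → β) (c : ListChain α) :
    boundary (map f c) = map f (boundary c) := by
  have : boundary ∘ₗ map f = map f ∘ₗ (boundary : ListChain α →ₗ[ZMod 2] _) := by
    ext l : 2
    simp [map_listBoundary]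
  exact LinearMap.congr_fun this c

lemma map_map {γ : Type*} (g : β → γ) (f : α → β) (c : ListChain α) :
    map g (map f c) = map (g ∘ f) c := by
  have : map g ∘ₗ map f = map (g ∘ f) := by
    ext l : 2
    simp
  exact LinearMap.congr_fun this c

lemma map_id (c : ListChain α) : map id c = c := by
  have : map (id : α → α) = LinearMap.id := by
    ext l : 2
    simp
  exact LinearMap.congr_fun this c

/-- The list chain of the prism over `l` spanned by the images of `l` under two maps. -/
noncomputable def listPrism (f g : α → β) : List α → ListChain β
  | [] => 0
  | a :: l => Finsupp.single (f a :: (a :: l).map g) 1 + cone (f a) (listPrism f g l)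

/-- The prism operator, a chain homotopy between `map f` and `map g`. -/
noncomputable def prism (f g : α → β) : ListChain α →ₗ[ZMod 2] ListChain β :=
  Finsupp.linearCombination (ZMod 2) (listPrism f g)

@[simp] lemma prism_single (f g : α → β) (l : List α) :
    prism f g (Finsupp.single l 1) = listPrism f g l := by
  simp [prism]

lemma prism_cone (f g : α → β) (a : α) (c : ListChain α) :
    prism f g (cone a c) = cone (f a) (map g (cone a c)) + cone (f a) (prism f g c) := by
  have : prism f g ∘ₗ cone a =
      cone (f a) ∘ₗ map g ∘ₗ cone a + cone (f a) ∘ₗ prism f g := by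
    ext l : 2
    simp [listPrism]
  exact LinearMap.congr_fun this c

lemma boundary_listPrism (f g : α → β) (l : List α) :
    boundary (listPrism f g l) + prism f g (listBoundary l) =
      Finsupp.single (l.map f) 1 + Finsupp.single (l.map g) 1 := by
  induction l with
  | nil => simp [listPrism, ZModModule.add_self]
  | cons a l ih =>
    have h : prism f g (listBoundary l) = boundary (listPrism f g l) +
        (Finsupp.single (l.map f) 1 + Finsupp.single (l.map g) 1) := by
      rw [← ih, ← add_assoc, ZModModule.add_self, zero_add]
    have key (x y z u v w : ListChain β) :
        x + (y + z) + (u + v) + (u + (z + (v + (w + y)))) = w + x := by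
      have e : x + (y + z) + (u + v) + (u + (z + (v + (w + y)))) =
          w + x + ((y + y) + (z + z) + (u + u) + (v + v)) := by abel
      simp [e, ZModModule.add_self]
    simp only [listPrism, listBoundary_cons, List.map_cons, map_add, boundary_single,
      boundary_cone, prism_single, prism_cone, map_cone, map_listBoundary, cone_single, h]
    exact key _ _ _ _ _ _

lemma boundary_prism (f g : α → β) (c : ListChain α) :
    boundary (prism f g c) + prism f g (boundary c) = map f c + map g c := by
  have : boundary ∘ₗ prism f g + prism f g ∘ₗ boundary = map f + map g := by
    ext l : 2
    simpa using boundary_listPrism f g l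
  exact LinearMap.congr_fun this c

lemma map_prism {γ : Type*} (h : β → γ) (f g : α → β) (c : ListChain α) :
    map h (prism f g c) = prism (h ∘ f) (h ∘ g) c := by
  have : map h ∘ₗ prism f g = prism (h ∘ f) (h ∘ g) := by
    ext l : 2
    simp only [LinearMap.comp_apply, Finsupp.lsingle_apply, prism_single]
    induction l with
    | nil => simp [listPrism]
    | cons a l ih => simp [listPrism, map_cone, ih]
  exact LinearMap.congr_fun this c

lemma prism_map {γ : Type*} (f g : β → γ) (h : α → β) (c : ListChain α) :
    prism f g (map h c) = prism (f ∘ h) (g ∘ h) c := by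
  have : prism f g ∘ₗ map h = prism (f ∘ h) (g ∘ h) := by
    ext l : 2
    simp only [LinearMap.comp_apply, Finsupp.lsingle_apply, map_single, prism_single]
    induction l with
    | nil => simp [listPrism]
    | cons a l ih => simp [listPrism, ih]
  exact LinearMap.congr_fun this c

end ListChain

/-- A linear map sends chains supported in `S` into a submodule as soon as it sends the basis
elements of `S` there. -/
lemma Finsupp.map_mem_of_mem_supported {α M : Type*} [AddCommGroup M] [Module (ZMod 2) M]
    (L : (α →₀ ZMod 2) →ₗ[ZMod 2] M) {S : Set α} {T : Submodule (ZMod 2) M}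
    (h : ∀ a ∈ S, L (Finsupp.single a 1) ∈ T) {c : α →₀ ZMod 2}
    (hc : c ∈ Finsupp.supported (ZMod 2) (ZMod 2) S) : L c ∈ T := by
  rw [Finsupp.supported_eq_span_single] at hc
  have : Submodule.span (ZMod 2) ((fun a ↦ Finsupp.single a (1 : ZMod 2)) '' S) ≤
      T.comap L := by
    rw [Submodule.span_le]
    rintro _ ⟨a, ha, rfl⟩
    exact h a ha
  exact this hc

/-- Linear maps agreeing on the basis elements of `S` agree on chains supported in `S`. -/
lemma Finsupp.map_congr_of_mem_supported {α M : Type*} [AddCommGroup M] [Module (ZMod 2) M]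
    (L L' : (α →₀ ZMod 2) →ₗ[ZMod 2] M) {S : Set α}
    (h : ∀ a ∈ S, L (Finsupp.single a 1) = L' (Finsupp.single a 1)) {c : α →₀ ZMod 2}
    (hc : c ∈ Finsupp.supported (ZMod 2) (ZMod 2) S) : L c = L' c := by
  have := map_mem_of_mem_supported (L - L') (T := ⊥)
    (fun a ha ↦ by simp [h a ha]) hc
  simpa [sub_eq_zero] using this

namespace ListChain

variable {α β : Type*}

/-- List chains supported on a set of lists. -/
abbrev supp (S : Set (List α)) : Submodule (ZMod 2) (ListChain α) :=
  Finsupp.supported (ZMod 2) (ZMod 2) S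

lemma cone_mem_supp {S T : Set (List α)} {a : α} (h : ∀ l ∈ S, a :: l ∈ T) {c : ListChain α}
    (hc : c ∈ supp S) : cone a c ∈ supp T :=
  Finsupp.map_mem_of_mem_supported _
    (fun l hl ↦ by simpa using Finsupp.single_mem_supported _ _ (h l hl)) hc

lemma map_mem_supp {S : Set (List α)} {T : Set (List β)} {f : α → β}
    (h : ∀ l ∈ S, l.map f ∈ T) {c : ListChain α} (hc : c ∈ supp S) : map f c ∈ supp T :=
  Finsupp.map_mem_of_mem_supported _
    (fun l hl ↦ by simpa using Finsupp.single_mem_supported _ _ (h l hl)) hc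

lemma map_congr {S : Set (List α)} {f g : α → β} (h : ∀ l ∈ S, ∀ x ∈ l, f x = g x)
    {c : ListChain α} (hc : c ∈ supp S) : map f c = map g c :=
  Finsupp.map_congr_of_mem_supported _ _
    (fun l hl ↦ by simp [List.map_congr_left (h l hl)]) hc

lemma listPrism_mem_supp (f g : α → β) (l : List α) :
    listPrism f g l ∈ supp {l' | l'.length = l.length + 1 ∧ ∀ x ∈ l', ∃ y ∈ l, x = f y ∨ x = g y} := by
  induction l with
  | nil => exact zero_mem _
  | cons a l ih =>
    refine add_mem (Finsupp.single_mem_supported _ _ ⟨by simp, ?_⟩) (cone_mem_supp ?_ ih)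
    · intro x hx
      simp only [List.mem_cons, List.mem_map, List.map_cons] at hx ⊢
      aesop
    · rintro l' ⟨h1, h2⟩
      refine ⟨by simp [h1], fun x hx ↦ ?_⟩
      rcases List.mem_cons.1 hx with rfl | hx
      · exact ⟨a, by simp, Or.inl rfl⟩
      · obtain ⟨y, hy, h⟩ := h2 x hx
        exact ⟨y, by simp [hy], h⟩

lemma listBoundary_mem_supp (l : List α) :
    listBoundary l ∈ supp {l' | l'.length + 1 = l.length ∧ l' ⊆ l} := by
  refine sum_mem fun i _ ↦ Finsupp.single_mem_supported _ _ ⟨?_, List.eraseIdx_subset⟩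
  rw [List.length_eraseIdx_of_lt i.2]
  have := i.2
  omega

section Fill

variable {E F : Type*} [NormedAddCommGroup E] [NormedSpace ℝ E]
  [NormedAddCommGroup F] [NormedSpace ℝ F]

/-- The lists of length `n` in `S` all of whose points are `ε`-close to each other. -/
def fineLists (S : Set E) (ε : ℝ) (n : ℕ) : Set (List E) :=
  {l | l.length = n ∧ (∀ x ∈ l, x ∈ S) ∧ ∀ x ∈ l, ∀ y ∈ l, dist x y ≤ ε}

/-- The contraction towards `a`, at time `j / N`. -/
noncomputable def contraction (N : ℕ) (a : E) (j : ℕ) (x : E) : E :=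
  AffineMap.lineMap x a (j / N : ℝ)

/-- A chain bounded by `c` if `c` is a cycle, obtained by contracting `c` to `a` in `N` steps. -/
noncomputable def fill (N : ℕ) (a : E) (c : ListChain E) : ListChain E :=
  ∑ j ∈ Finset.range N, prism (contraction N a j) (contraction N a (j + 1)) c +
    cone a (map (fun _ ↦ a) c)

lemma contraction_zero (N : ℕ) (a : E) : contraction N a 0 = id := by
  ext x; simp [contraction]

lemma contraction_self {N : ℕ} (hN : N ≠ 0) (a : E) : contraction N a N = fun _ ↦ a := by
  ext x; simp [contraction, hN]

lemma boundary_fill {N : ℕ} (hN : N ≠ 0) (a : E) {c : ListChain E} (hc : boundary c = 0) :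
    boundary (fill N a c) = c := by
  have h1 (j : ℕ) : boundary (prism (contraction N a j) (contraction N a (j + 1)) c) =
      map (contraction N a (j + 1)) c - map (contraction N a j) c := by
    have := boundary_prism (contraction N a j) (contraction N a (j + 1)) c
    rw [hc, map_zero, add_zero] at this
    rw [this, ZModModule.sub_eq_add, add_comm]
  simp only [fill, map_add, map_sum, h1, boundary_cone, boundary_map, hc, map_zero, add_zero]
  rw [Finset.sum_range_sub (fun j ↦ map (contraction N a j) c), contraction_zero,
    contraction_self hN, map_id, ZModModule.sub_eq_add, add_right_comm, ZModModule.add_self,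
    zero_add]

lemma map_fill (g : E →ₗ[ℝ] F) (N : ℕ) (a : E) (c : ListChain E) :
    map g (fill N a c) = fill N (g a) (map g c) := by
  have h (j : ℕ) : g ∘ contraction N a j = contraction N (g a) j ∘ g := by
    ext x
    simp [contraction, AffineMap.lineMap_apply]
  simp only [fill, map_add, map_sum, map_prism, prism_map, map_cone, map_map, h]
  rfl

lemma fill_mem_supp {S : Set E} (hS : Convex ℝ S) {R ε δ : ℝ} {N n : ℕ} (hN : N ≠ 0)
    (hε : 0 ≤ ε) (hδ : 0 ≤ δ) (hR : R ≤ N * δ) (hdiam : ∀ x ∈ S, ∀ y ∈ S, dist x y ≤ R)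
    {a : E} (ha : a ∈ S) {c : ListChain E} (hc : c ∈ supp (fineLists S ε n)) :
    fill N a c ∈ supp (fineLists S (ε + δ) (n + 1)) := by
  have hN' : (0 : ℝ) < N := by positivity
  have hmem (j : ℕ) (hj : j ≤ N) (x : E) (hx : x ∈ S) : contraction N a j x ∈ S := by
    refine hS.segment_subset hx ha ?_
    rw [segment_eq_image_lineMap]
    exact ⟨_, ⟨by positivity, div_le_one_of_le₀ (by exact_mod_cast hj) hN'.le⟩, rfl⟩
  have hsame (j : ℕ) (hj : j ≤ N) (x y : E) :
      dist (contraction N a j x) (contraction N a j y) ≤ dist x y := by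
    have h0 : (0 : ℝ) ≤ j / N := by positivity
    have h1 : (j / N : ℝ) ≤ 1 := div_le_one_of_le₀ (by exact_mod_cast hj) hN'.le
    have : contraction N a j x - contraction N a j y = (1 - j / N : ℝ) • (x - y) := by
      simp only [contraction, AffineMap.lineMap_apply_module]
      module
    rw [dist_eq_norm, this, norm_smul, dist_eq_norm, Real.norm_eq_abs,
      abs_of_nonneg (by linarith)]
    exact mul_le_of_le_one_left (norm_nonneg _) (by linarith)
  have hstep (j : ℕ) (x : E) (hx : x ∈ S) :
      dist (contraction N a j x) (contraction N a (j + 1) x) ≤ δ := by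
    have : contraction N a j x - contraction N a (j + 1) x = (1 / N : ℝ) • (x - a) := by
      simp only [contraction, AffineMap.lineMap_apply_module, Nat.cast_add, Nat.cast_one]
      module
    rw [dist_eq_norm, this, norm_smul, ← dist_eq_norm, Real.norm_eq_abs,
      abs_of_nonneg (by positivity), one_div, inv_mul_le_iff₀ hN']
    exact (hdiam x hx a ha).trans hR
  refine add_mem (sum_mem fun j hj ↦ ?_) ?_
  · have hj : j + 1 ≤ N := Finset.mem_range.1 hj
    refine Finsupp.map_mem_of_mem_supported _ (fun l hl ↦ ?_) hc
    rw [prism_single]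
    refine Finsupp.supported_mono ?_ (listPrism_mem_supp _ _ l)
    obtain ⟨hl, hlS, hld⟩ := hl
    rintro l' ⟨h1, h2⟩
    refine ⟨by rw [h1, hl], fun x hx ↦ ?_, fun x hx y hy ↦ ?_⟩
    · obtain ⟨y, hy, rfl | rfl⟩ := h2 x hx
      · exact hmem _ (by omega) _ (hlS _ hy)
      · exact hmem _ hj _ (hlS _ hy)
    · obtain ⟨x, hxl, hx'⟩ := h2 x hx
      obtain ⟨y, hyl, hy'⟩ := h2 y hy
      have hxy := hld x hxl y hyl
      rcases hx' with rfl | rfl <;> rcases hy' with rfl | rfl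
      · linarith [hsame j (by omega) x y]
      · linarith [dist_triangle (contraction N a j x) (contraction N a j y)
          (contraction N a (j + 1) y), hsame j (by omega) x y, hstep j y (hlS y hyl)]
      · linarith [dist_triangle (contraction N a (j + 1) x) (contraction N a j x)
          (contraction N a j y), hsame j (by omega) x y, hstep j x (hlS x hxl),
          dist_comm (contraction N a (j + 1) x) (contraction N a j x)]
      · linarith [hsame (j + 1) hj x y]
  · refine cone_mem_supp ?_ (map_mem_supp (T := {l | l.length = n ∧ ∀ x ∈ l, x = a}) ?_ hc)
    · rintro l ⟨h1, h2⟩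
      have h3 : ∀ x ∈ a :: l, x = a := by simpa using h2
      refine ⟨by simp [h1], fun x hx ↦ (h3 x hx).symm ▸ ha, fun x hx y hy ↦ ?_⟩
      rw [h3 x hx, h3 y hy, dist_self]
      positivity
    · rintro l ⟨h1, -⟩
      exact ⟨by simp [h1], by simp⟩

end Fill

section Subdivision

variable {E F : Type*} [NormedAddCommGroup E] [NormedSpace ℝ E]
  [NormedAddCommGroup F] [NormedSpace ℝ F]

/-- The subdivision of the affine simplex with vertices `l`, in which the subdivided boundary is
filled by contracting it in `N` steps to the first vertex. -/
noncomputable def listSubdivision (N : ℕ) : List E → ListChain E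
  | [] => Finsupp.single [] 1
  | a :: l => fill N a (∑ i : Fin (l.length + 1), listSubdivision N ((a :: l).eraseIdx i))
termination_by l => l.length
decreasing_by
  rw [List.length_eraseIdx_of_lt i.2]
  simp

/-- The linear extension of `listSubdivision`. -/
noncomputable def subdivision (N : ℕ) : ListChain E →ₗ[ZMod 2] ListChain E :=
  Finsupp.linearCombination (ZMod 2) (listSubdivision N)

@[simp] lemma subdivision_single (N : ℕ) (l : List E) :
    subdivision N (Finsupp.single l 1) = listSubdivision N l := by
  simp [subdivision]

lemma listSubdivision_cons (N : ℕ) (a : E) (l : List E) :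
    listSubdivision N (a :: l) = fill N a (subdivision N (listBoundary (a :: l))) := by
  rw [listSubdivision, listBoundary, map_sum]
  simp only [subdivision_single]
  rfl

lemma boundary_listSubdivision {N : ℕ} (hN : N ≠ 0) (l : List E) :
    boundary (listSubdivision N l) = subdivision N (listBoundary l) := by
  induction hn : l.length generalizing l with
  | zero =>
    obtain rfl := List.length_eq_zero_iff.1 hn
    simp [listSubdivision]
  | succ n ih =>
    obtain ⟨a, l, rfl⟩ := List.exists_cons_of_length_eq_add_one hn
    rw [listSubdivision_cons]
    refine boundary_fill hN a ?_
    have := Finsupp.map_congr_of_mem_supported (boundary ∘ₗ subdivision N)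
      (subdivision N ∘ₗ boundary) (fun l' hl' ↦ ?_) (listBoundary_mem_supp (a :: l))
    · simpa [boundary_listBoundary] using this
    · simpa using ih l' (by have := hl'.1; omega)

lemma map_listSubdivision (N : ℕ) (g : E →ₗ[ℝ] F) (l : List E) :
    map g (listSubdivision N l) = listSubdivision N (l.map g) := by
  induction hn : l.length generalizing l with
  | zero =>
    obtain rfl := List.length_eq_zero_iff.1 hn
    simp [listSubdivision]
  | succ n ih =>
    obtain ⟨a, l, rfl⟩ := List.exists_cons_of_length_eq_add_one hn
    rw [List.map_cons, listSubdivision_cons, listSubdivision_cons, map_fill, ← List.map_cons,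
      ← map_listBoundary]
    congr 1
    refine Finsupp.map_congr_of_mem_supported (map g ∘ₗ subdivision N)
      (subdivision N ∘ₗ map g) (fun l' hl' ↦ ?_) (listBoundary_mem_supp (a :: l))
    simpa using ih l' (by have := hl'.1; omega)

lemma listSubdivision_mem_supp {S : Set E} (hS : Convex ℝ S) {R δ : ℝ} {N : ℕ} (hN : N ≠ 0)
    (hδ : 0 ≤ δ) (hR : R ≤ N * δ) (hdiam : ∀ x ∈ S, ∀ y ∈ S, dist x y ≤ R)
    {l : List E} (hl : ∀ x ∈ l, x ∈ S) :
    listSubdivision N l ∈ supp (fineLists S (l.length * δ) l.length) := by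
  induction hn : l.length generalizing l with
  | zero =>
    obtain rfl := List.length_eq_zero_iff.1 hn
    simpa [listSubdivision] using Finsupp.single_mem_supported _ _ (by simp [fineLists])
  | succ n ih =>
    obtain ⟨a, l, rfl⟩ := List.exists_cons_of_length_eq_add_one hn
    rw [listSubdivision_cons, Nat.cast_succ, add_one_mul]
    refine fill_mem_supp hS hN (by positivity) hδ hR hdiam (hl a (by simp)) ?_
    refine Finsupp.map_mem_of_mem_supported _ (fun l' hl' ↦ ?_) (listBoundary_mem_supp (a :: l))
    rw [subdivision_single]
    exact ih (fun x hx ↦ hl x (hl'.2 hx)) (by have := hl'.1; omega)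

end Subdivision

section Label

variable {ι : Type*} [DecidableEq ι]

/-- The indicator modulo 2 of the orderings of the finite set `s`. -/
noncomputable def isOrdering : Finset ι → List ι → ZMod 2
  | s, [] => if s = ∅ then 1 else 0
  | s, a :: l => if a ∈ s then isOrdering (s.erase a) l else 0

/-- The number modulo 2 of orderings of `s` in a chain. -/
noncomputable def orderingCount (s : Finset ι) : ListChain ι →ₗ[ZMod 2] ZMod 2 :=
  Finsupp.linearCombination (ZMod 2) (isOrdering s)

@[simp] lemma orderingCount_single (s : Finset ι) (l : List ι) :
    orderingCount s (Finsupp.single l 1) = isOrdering s l := by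
  simp [orderingCount]

lemma mem_of_isOrdering_ne_zero {s : Finset ι} {l : List ι} (h : isOrdering s l ≠ 0)
    {a : ι} (ha : a ∈ s) : a ∈ l := by
  induction l generalizing s with
  | nil =>
    rw [isOrdering] at h
    aesop
  | cons b l ih =>
    rw [isOrdering] at h
    by_cases hb : b ∈ s
    · rw [if_pos hb] at h
      by_cases hab : a = b
      · simp [hab]
      · exact List.mem_cons_of_mem _ (ih h (by simp [ha, hab]))
    · simp [hb] at h

lemma orderingCount_cone (s : Finset ι) (a : ι) (c : ListChain ι) :
    orderingCount s (cone a c) = if a ∈ s then orderingCount (s.erase a) c else 0 := by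
  have : orderingCount s ∘ₗ cone a = if a ∈ s then orderingCount (s.erase a) else 0 := by
    ext l : 2
    by_cases h : a ∈ s <;> simp [isOrdering, h]
  have := LinearMap.congr_fun this c
  by_cases h : a ∈ s <;> simpa [h] using this

lemma orderingCount_listBoundary [Fintype ι] (s : Finset ι) (l : List ι) :
    orderingCount s (listBoundary l) = ∑ j ∈ sᶜ, isOrdering (insert j s) l := by
  induction l generalizing s with
  | nil => simp [isOrdering]
  | cons a l ih =>
    rw [listBoundary_cons, map_add, orderingCount_single, orderingCount_cone]
    simp only [isOrdering]
    split_ifs with ha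
    · rw [ih, Finset.compl_erase, Finset.sum_insert (by simp [ha]), Finset.insert_erase ha,
        ← add_assoc, CharTwo.add_self_eq_zero, zero_add]
      refine Finset.sum_congr rfl fun j hj ↦ ?_
      have hja : j ≠ a := by rintro rfl; simp [ha] at hj
      rw [if_pos (by simp [ha]), Finset.erase_insert_of_ne hja]
    · rw [add_zero, Finset.sum_eq_single a]
      · simp [ha]
      · intro j _ hja
        simp [ha, Ne.symm hja]
      · simp [ha]

lemma orderingCount_boundary [Fintype ι] (s : Finset ι) (c : ListChain ι) :
    orderingCount s (boundary c) = ∑ j ∈ sᶜ, orderingCount (insert j s) c := by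
  have : orderingCount s ∘ₗ boundary = ∑ j ∈ sᶜ, orderingCount (insert j s) := by
    ext l : 2
    simpa using orderingCount_listBoundary s l
  simpa using LinearMap.congr_fun this c

lemma orderingCount_eq_zero {s : Finset ι} {a : ι} (ha : a ∈ s) {c : ListChain ι}
    (hc : c ∈ supp {l : List ι | a ∉ l}) : orderingCount s c = 0 := by
  refine Finsupp.map_congr_of_mem_supported (orderingCount s) 0 (fun l hl ↦ ?_) hc
  by_contra h
  exact hl (mem_of_isOrdering_ne_zero (by simpa using h) ha)

/-- A homological Sperner lemma: a chain map from the simplices on `ι` to list chains that is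
carried by the identity has an odd number of orderings of `s` in the image of `s`. -/
lemma orderingCount_eq_one [Fintype ι] (γ : Finset ι → ListChain ι)
    (h0 : γ ∅ = Finsupp.single [] 1)
    (hmem : ∀ s, s ≠ Finset.univ → ∀ i ∉ s, γ s ∈ supp {l : List ι | i ∉ l})
    (hbd : ∀ s, s ≠ ∅ → boundary (γ s) = ∑ i ∈ s, γ (s.erase i)) (s : Finset ι) :
    orderingCount s (γ s) = 1 := by
  induction s using Finset.induction_on with
  | empty => simp [h0, isOrdering]
  | insert a s ha ih =>
    have hs : s ≠ Finset.univ := by rintro rfl; simp at ha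
    have h1 := congrArg (orderingCount s) (hbd (insert a s) (by simp))
    rw [orderingCount_boundary, map_sum, Finset.sum_insert ha, Finset.erase_insert ha, ih,
      Finset.sum_eq_zero (s := s), add_zero, Finset.sum_eq_single a] at h1
    · exact h1
    · intro j hj hja
      refine orderingCount_eq_zero (Finset.mem_insert_self j s) ?_
      refine hmem _ (fun h ↦ ?_) j (by simp at hj; simp [hj, hja])
      have := h ▸ Finset.mem_univ j
      simp at hj
      simp [hj, hja] at this
    · simp [ha]
    · intro j hj
      exact orderingCount_eq_zero hj (hmem _ (fun h ↦ Finset.notMem_erase j _ (h ▸ Finset.mem_univ j)) j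
        (by simp))

end Label

end ListChain

/-- Mod 2 singular chains of `X` in all degrees. The simplices are indexed by their number of
vertices, so that the unique simplex without vertices provides the augmentation. -/
abbrev SingularChain (X : Type*) [TopologicalSpace X] :=
  (Σ m : ℕ, C(stdSimplex ℝ (Fin m), X)) →₀ ZMod 2

namespace SingularChain

section Topological

variable {X : Type*} [TopologicalSpace X]

instance : IsEmpty (stdSimplex ℝ (Fin 0)) :=
  ⟨fun p ↦ by simpa using p.2.2⟩

/-- The inclusion of a facet of the standard simplex. -/
noncomputable def facet {m : ℕ} (i : Fin (m + 1)) :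
    C(stdSimplex ℝ (Fin m), stdSimplex ℝ (Fin (m + 1))) :=
  ⟨stdSimplex.map i.succAbove, stdSimplex.continuous_map _⟩

/-- The sum of the facets of a singular simplex. -/
noncomputable def simplexBoundary : (Σ m : ℕ, C(stdSimplex ℝ (Fin m), X)) → SingularChain X
  | ⟨0, _⟩ => 0
  | ⟨m + 1, σ⟩ => ∑ i : Fin (m + 1), Finsupp.single ⟨m, σ.comp (facet i)⟩ 1

/-- The augmented mod 2 singular boundary operator. -/
noncomputable def boundary : SingularChain X →ₗ[ZMod 2] SingularChain X :=
  Finsupp.linearCombination (ZMod 2) simplexBoundary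

@[simp] lemma boundary_single (σ : Σ m : ℕ, C(stdSimplex ℝ (Fin m), X)) :
    boundary (Finsupp.single σ 1) = simplexBoundary σ := by
  simp [boundary]

/-- Singular chains in `A` all of whose simplices have `m` vertices. -/
def chainsIn (A : Set X) (m : ℕ) : Submodule (ZMod 2) (SingularChain X) :=
  Finsupp.supported (ZMod 2) (ZMod 2) {σ | σ.1 = m ∧ ∀ p, σ.2 p ∈ A}

lemma chainsIn_mono {A B : Set X} (h : A ⊆ B) (m : ℕ) : chainsIn A m ≤ chainsIn B m :=
  Finsupp.supported_mono fun _ hσ ↦ ⟨hσ.1, fun p ↦ h (hσ.2 p)⟩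

end Topological

end SingularChain

namespace ListChain

open SingularChain

lemma listBoundary_ofFn {α : Type*} {m : ℕ} (v : Fin (m + 1) → α) :
    listBoundary (List.ofFn v) =
      ∑ i : Fin (m + 1), Finsupp.single (List.ofFn fun j ↦ v (i.succAbove j)) 1 := by
  induction m with
  | zero => simp [listBoundary_cons]
  | succ m ih =>
    rw [List.ofFn_succ, listBoundary_cons, Fin.sum_univ_succ, ih]
    simp [List.ofFn_succ]

variable {E : Type*} [NormedAddCommGroup E]

/-- The list of vertices of the standard simplex. -/
noncomputable def vertices (m : ℕ) : List (Fin m → ℝ) :=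
  List.ofFn fun i ↦ Pi.single i 1

@[simp] lemma length_vertices (m : ℕ) : (vertices m).length = m := by
  simp [vertices]

lemma mem_stdSimplex_of_mem_vertices {m : ℕ} {x : Fin m → ℝ} (hx : x ∈ vertices m) :
    x ∈ stdSimplex ℝ (Fin m) := by
  simp only [vertices, List.mem_ofFn] at hx
  obtain ⟨i, rfl⟩ := hx
  exact single_mem_stdSimplex ℝ i

/-- The map on `ℝᵐ` extending a singular simplex by zero. -/
noncomputable def extendByZero {m : ℕ} (σ : C(stdSimplex ℝ (Fin m), E)) : (Fin m → ℝ) → E :=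
  Function.extend Subtype.val σ 0

lemma extendByZero_coe {m : ℕ} (σ : C(stdSimplex ℝ (Fin m), E)) (x : stdSimplex ℝ (Fin m)) :
    extendByZero σ x = σ x :=
  Subtype.val_injective.extend_apply _ _ _

/-- The subdivision of a singular simplex, remembering only the vertices of the small simplices. -/
noncomputable def simplexSubdivision (N : ℕ) (σ : Σ m : ℕ, C(stdSimplex ℝ (Fin m), E)) :
    ListChain E :=
  map (extendByZero σ.2) (listSubdivision N (vertices σ.1))

/-- The linear extension of `simplexSubdivision`. -/
noncomputable def ofSingular (N : ℕ) : SingularChain E →ₗ[ZMod 2] ListChain E :=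
  Finsupp.linearCombination (ZMod 2) (simplexSubdivision N)

@[simp] lemma ofSingular_single (N : ℕ) (σ : Σ m : ℕ, C(stdSimplex ℝ (Fin m), E)) :
    ofSingular N (Finsupp.single σ 1) = simplexSubdivision N σ := by
  simp [ofSingular]

lemma listSubdivision_vertices_mem_supp {N : ℕ} (hN : N ≠ 0) {δ : ℝ} (hδ : 0 ≤ δ)
    (h : 1 ≤ N * δ) (m : ℕ) :
    listSubdivision N (vertices m) ∈ supp (fineLists (stdSimplex ℝ (Fin m)) (m * δ) m) := by
  have := listSubdivision_mem_supp (convex_stdSimplex ℝ (Fin m)) hN hδ h (fun x hx y hy ↦ ?_)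
    (l := vertices m) fun x ↦ mem_stdSimplex_of_mem_vertices
  · simpa using this
  · exact (Metric.dist_le_diam_of_mem (bounded_stdSimplex _) hx hy).trans diam_stdSimplex_le

lemma boundary_simplexSubdivision {N : ℕ} (hN : N ≠ 0)
    (σ : Σ m : ℕ, C(stdSimplex ℝ (Fin m), E)) :
    boundary (simplexSubdivision N σ) = ofSingular N (simplexBoundary σ) := by
  obtain ⟨_ | m, σ⟩ := σ
  · simp [simplexSubdivision, simplexBoundary, vertices, listSubdivision]
  · rw [simplexSubdivision, boundary_map, boundary_listSubdivision hN, vertices,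
      listBoundary_ofFn]
    simp only [simplexBoundary, map_sum, subdivision_single, ofSingular_single]
    refine Finset.sum_congr rfl fun i _ ↦ ?_
    have h : (List.ofFn fun j ↦ (Pi.single (i.succAbove j) 1 : Fin (m + 1) → ℝ)) =
        (vertices m).map (FunOnFinite.linearMap ℝ ℝ i.succAbove) := by
      simp [vertices, List.map_ofFn, Function.comp_def]
    rw [h, ← map_listSubdivision, map_map, simplexSubdivision]
    refine map_congr (fun l hl x hx ↦ ?_)
      (listSubdivision_vertices_mem_supp hN zero_le_one (by simp; omega) m)
    exact (extendByZero_coe σ (facet i ⟨x, hl.2.1 x hx⟩)).trans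
      (extendByZero_coe (σ.comp (facet i)) ⟨x, hl.2.1 x hx⟩).symm

lemma boundary_ofSingular {N : ℕ} (hN : N ≠ 0) (c : SingularChain E) :
    boundary (ofSingular N c) = ofSingular N (SingularChain.boundary c) := by
  have : boundary ∘ₗ ofSingular N = ofSingular N ∘ₗ (SingularChain.boundary (X := E)) := by
    ext σ : 2
    simpa using boundary_simplexSubdivision hN σ
  exact LinearMap.congr_fun this c

lemma eventually_simplexSubdivision_mem_supp (σ : Σ m : ℕ, C(stdSimplex ℝ (Fin m), E))
    {ε : ℝ} (hε : 0 < ε) :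
    ∀ᶠ N in Filter.atTop,
      simplexSubdivision N σ ∈ supp (fineLists (Set.range σ.2) ε σ.1) := by
  obtain ⟨m, σ⟩ := σ
  have hK : CompactSpace (stdSimplex ℝ (Fin m)) :=
    isCompact_iff_compactSpace.1 (isCompact_stdSimplex _ _)
  obtain ⟨δ, hδ, h⟩ := Metric.uniformContinuous_iff.1
    (CompactSpace.uniformContinuous_of_continuous σ.continuous) ε hε
  have hη : 0 < δ / (m + 1) := by positivity
  obtain ⟨N₀, hN₀⟩ := exists_nat_gt (1 / (δ / (m + 1)))
  filter_upwards [Filter.eventually_ge_atTop (N₀ + 1)] with N hN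
  have hN' : 1 ≤ N * (δ / (m + 1)) := by
    rw [← div_le_iff₀ hη]
    exact hN₀.le.trans (by exact_mod_cast (Nat.le_succ _).trans hN)
  refine map_mem_supp ?_ (listSubdivision_vertices_mem_supp (by omega) hη.le hN' m)
  rintro l ⟨h1, h2, h3⟩
  refine ⟨by simp [h1], fun x hx ↦ ?_, fun x hx y hy ↦ ?_⟩
  · obtain ⟨x, hxl, rfl⟩ := List.mem_map.1 hx
    exact ⟨⟨x, h2 x hxl⟩, (extendByZero_coe σ ⟨x, h2 x hxl⟩).symm⟩
  · obtain ⟨x, hxl, rfl⟩ := List.mem_map.1 hx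
    obtain ⟨y, hyl, rfl⟩ := List.mem_map.1 hy
    refine (congrArg₂ dist (extendByZero_coe σ ⟨x, h2 x hxl⟩)
      (extendByZero_coe σ ⟨y, h2 y hyl⟩)).trans_le (h ?_).le
    refine (h3 x hxl y hyl).trans_lt ?_
    rw [mul_div_assoc', div_lt_iff₀ (by positivity)]
    linarith [mul_comm δ (m + 1)]

lemma eventually_ofSingular_mem_supp {m : ℕ} {A : Set E} {c : SingularChain E}
    (hc : c ∈ chainsIn A m) {ε : ℝ} (hε : 0 < ε) :
    ∀ᶠ N in Filter.atTop, ofSingular N c ∈ supp (fineLists A ε m) := by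
  have h := (Filter.eventually_all_finset c.support).2
    fun σ _ ↦ eventually_simplexSubdivision_mem_supp σ hε
  filter_upwards [h] with N hN
  refine Finsupp.map_mem_of_mem_supported _ (fun σ hσ ↦ ?_)
    (Finsupp.mem_supported_support (ZMod 2) c)
  rw [ofSingular_single]
  obtain ⟨rfl, hA⟩ := hc hσ
  refine Finsupp.supported_mono ?_ (hN σ hσ)
  rintro l ⟨h1, h2, h3⟩
  refine ⟨h1, fun x hx ↦ ?_, h3⟩
  obtain ⟨p, rfl⟩ := h2 x hx
  exact hA p

end ListChain

section Radon

variable {ι : Type*} [DecidableEq ι]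

lemma Finset.sum_sum_erase_erase {M : Type*} [AddCommGroup M] [Module (ZMod 2) M]
    (f : Finset ι → M) (s : Finset ι) :
    ∑ i ∈ s, ∑ j ∈ s.erase i, f ((s.erase i).erase j) = 0 := by
  rw [Finset.sum_sigma']
  refine Finset.sum_involution (fun p _ ↦ ⟨p.2, p.1⟩) ?_ ?_ ?_ ?_
  · rintro ⟨i, j⟩ -
    rw [Finset.erase_right_comm, ZModModule.add_self]
  · rintro ⟨i, j⟩ h -
    simp only [Finset.mem_sigma, Finset.mem_erase] at h
    simp [h.2.1]
  · rintro ⟨i, j⟩ h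
    simp only [Finset.mem_sigma, Finset.mem_erase] at h ⊢
    exact ⟨h.2.2, h.2.1.symm, h.1⟩
  · rintro ⟨i, j⟩ -
    rfl

variable [Fintype ι]

/-- A family of singular chains indexed by the proper faces of the simplex on `ι`, compatible with
the boundary operators and the augmentations. -/
structure IsBoundaryChainMap {X : Type*} [TopologicalSpace X] (γ : Finset ι → SingularChain X) :
    Prop where
  empty : ∃ σ, γ ∅ = Finsupp.single ⟨0, σ⟩ 1
  boundary : ∀ s, s ≠ ∅ → s ≠ Finset.univ →
    SingularChain.boundary (γ s) = ∑ i ∈ s, γ (s.erase i)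

variable {E : Type*} [NormedAddCommGroup E] [NormedSpace ℝ E]

/-- If a chain map from the boundary of the simplex on `ι` to a normed space sends every proper
face to a chain whose points are labelled by vertices of that face, then all labels appear in an
arbitrarily small set. -/
lemma IsBoundaryChainMap.exists_label_eq [Nonempty ι] {γ : Finset ι → SingularChain E}
    (hγ : IsBoundaryChainMap γ) (lab : E → ι) {r : ℝ} (hr : 0 ≤ r)
    (hmem : ∀ s, s ≠ Finset.univ →
      γ s ∈ SingularChain.chainsIn {x ∈ Metric.closedBall 0 r | lab x ∈ s} s.card)
    {ε : ℝ} (hε : 0 < ε) :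
    ∃ x : ι → E, (∀ i, lab (x i) = i) ∧ (∀ i, x i ∈ Metric.closedBall 0 r) ∧
      ∀ i j, dist (x i) (x j) ≤ ε := by
  have hev := (Filter.eventually_all_finset (Finset.univ.erase Finset.univ)).2
    fun s hs ↦ ListChain.eventually_ofSingular_mem_supp (hmem s (Finset.ne_of_mem_erase hs))
      (half_pos hε)
  obtain ⟨N, hN, hN0⟩ := (hev.and (Filter.eventually_ge_atTop 1)).exists
  have hN0 : N ≠ 0 := by omega
  obtain ⟨M, hM⟩ := exists_nat_gt (2 * r / (ε / 2))
  have hM0 : M ≠ 0 := by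
    rintro rfl
    have : 0 ≤ 2 * r / (ε / 2) := by positivity
    norm_num at hM
    linarith
  have hM' : 2 * r ≤ M * (ε / 2) := ((div_lt_iff₀ (by positivity)).1 hM).le
  let γ' (s : Finset ι) : ListChain E := ListChain.ofSingular N (γ s)
  have hγ'0 : γ' ∅ = Finsupp.single [] 1 := by
    obtain ⟨σ, hσ⟩ := hγ.empty
    simp [γ', hσ, ListChain.simplexSubdivision, ListChain.vertices, ListChain.listSubdivision]
  have hγ' (s) (hs : s ≠ Finset.univ) : ListChain.boundary (γ' s) = ∑ i ∈ s, γ' (s.erase i) := by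
    by_cases h0 : s = ∅
    · simp [h0, hγ'0]
    · simp only [γ']
      rw [ListChain.boundary_ofSingular hN0, hγ.boundary s h0 hs, map_sum]
  have hne (i : ι) : Finset.univ.erase i ≠ Finset.univ :=
    fun h ↦ Finset.erase_eq_self.1 h (Finset.mem_univ i)
  let z : ListChain E := ∑ i, γ' (Finset.univ.erase i)
  have hz : ListChain.boundary z = 0 := by
    simp only [z, map_sum]
    rw [Finset.sum_congr rfl fun i _ ↦ hγ' _ (hne i)]
    exact Finset.sum_sum_erase_erase γ' Finset.univ
  have hz' : z ∈ ListChain.supp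
      (ListChain.fineLists (Metric.closedBall 0 r) (ε / 2) (Fintype.card ι - 1)) := by
    refine sum_mem fun i _ ↦ Finsupp.supported_mono ?_ (hN _ (by simp [hne i]))
    rintro l ⟨h1, h2, h3⟩
    exact ⟨by simp [h1], fun x hx ↦ (h2 x hx).1, h3⟩
  let c := ListChain.fill M 0 z
  have hc : ListChain.boundary c = z := ListChain.boundary_fill hM0 0 hz
  have hc' := ListChain.fill_mem_supp (convex_closedBall (0 : E) r) hM0 (half_pos hε).le
    (half_pos hε).le hM' (fun x hx y hy ↦ by
      linarith [dist_triangle_right x y 0, Metric.mem_closedBall.1 hx, Metric.mem_closedBall.1 hy])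
    (Metric.mem_closedBall_self hr) hz'
  have hcount := ListChain.orderingCount_eq_one
    (fun s ↦ ListChain.map lab (if s = Finset.univ then c else γ' s)) ?_ ?_ ?_ Finset.univ
  · rw [if_pos rfl] at hcount
    by_contra! hx
    refine one_ne_zero (hcount.symm.trans (Finsupp.map_congr_of_mem_supported
      (ListChain.orderingCount Finset.univ ∘ₗ ListChain.map lab) 0 (fun l hl ↦ ?_) hc'))
    by_contra h
    have hall (i : ι) : i ∈ l.map lab :=
      ListChain.mem_of_isOrdering_ne_zero (by simpa using h) (Finset.mem_univ i)
    choose x hxl hxi using fun i ↦ List.mem_map.1 (hall i)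
    obtain ⟨i, j, hij⟩ := hx x hxi fun i ↦ hl.2.1 _ (hxl i)
    linarith [hl.2.2 _ (hxl i) _ (hxl j)]
  · have : (∅ : Finset ι) ≠ Finset.univ := Finset.univ_nonempty.ne_empty.symm
    simp [this, hγ'0]
  · intro s hs i hi
    rw [if_neg hs]
    refine ListChain.map_mem_supp ?_ (hN s (by simp [hs]))
    rintro l ⟨-, h2, -⟩ hil
    obtain ⟨x, hx, rfl⟩ := List.mem_map.1 hil
    exact hi (h2 x hx).2
  · intro s _
    rw [ListChain.boundary_map, ← map_sum]
    congr 1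
    have h (i) (hi : i ∈ s) : s.erase i ≠ Finset.univ :=
      fun h ↦ Finset.notMem_erase i s (h ▸ Finset.mem_univ i)
    rw [Finset.sum_congr rfl fun i hi ↦ if_neg (h i hi)]
    split_ifs with hs
    · rw [hc, hs]
    · exact hγ' s hs

/-- **Homological Radon lemma**, in terms of the values of a continuous map to `ℝ^ι`. -/
lemma IsBoundaryChainMap.exists_forall_eq [Nonempty ι] [ProperSpace E]
    {γ : Finset ι → SingularChain E} (hγ : IsBoundaryChainMap γ) (A : Finset ι → Set E)
    (hmem : ∀ s, s ≠ Finset.univ → γ s ∈ SingularChain.chainsIn (A s) s.card)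
    (hA : ∀ s, Bornology.IsBounded (A s))
    {g : ι → E → ℝ} (hg : ∀ i, Continuous (g i))
    (hgA : ∀ s, s ≠ Finset.univ → ∀ x ∈ A s, ∀ i ∉ s, ∃ j, g i x < g j x) :
    ∃ y, ∀ i j, g i y = g j y := by
  obtain ⟨r, hr, hAr⟩ : ∃ r, 0 ≤ r ∧ ⋃ s, A s ⊆ Metric.closedBall 0 r := by
    obtain ⟨r, hr⟩ := ((Bornology.isBounded_iUnion).2 hA).subset_closedBall 0
    exact ⟨max r 0, le_max_right _ _,
      hr.trans (Metric.closedBall_subset_closedBall (le_max_left _ _))⟩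
  have hlab (x : E) : ∃ i, ∀ j, g j x ≤ g i x := Finite.exists_max fun i ↦ g i x
  choose lab hlab using hlab
  have hmem' (s) (hs : s ≠ Finset.univ) :
      γ s ∈ SingularChain.chainsIn {x ∈ Metric.closedBall 0 r | lab x ∈ s} s.card := by
    refine SingularChain.chainsIn_mono ?_ _ (hmem s hs)
    intro x hx
    refine ⟨hAr (Set.mem_iUnion_of_mem s hx), ?_⟩
    by_contra h
    obtain ⟨j, hj⟩ := hgA s hs x hx _ h
    exact hj.not_ge (hlab x j)
  choose x hx1 hx2 hx3 using fun n : ℕ ↦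
    hγ.exists_label_eq lab hr hmem' (Nat.one_div_pos_of_nat (α := ℝ) (n := n))
  let i₀ : ι := Classical.arbitrary ι
  obtain ⟨y, -, φ, hφ, hy⟩ := (isCompact_closedBall (0 : E) r).tendsto_subseq fun n ↦ hx2 n i₀
  have hlim (i : ι) : Filter.Tendsto (fun n ↦ x (φ n) i) Filter.atTop (nhds y) := by
    refine (tendsto_iff_of_dist ?_).1 hy
    exact squeeze_zero (fun _ ↦ dist_nonneg) (fun n ↦ hx3 (φ n) i₀ i)
      (tendsto_one_div_add_atTop_nhds_zero_nat.comp hφ.tendsto_atTop)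
  have hle (i j : ι) : g j y ≤ g i y :=
    le_of_tendsto_of_tendsto' (((hg j).tendsto y).comp (hlim i)) (((hg i).tendsto y).comp (hlim i))
      fun n ↦ by simpa [hx1] using hlab (x (φ n) i) j
  exact ⟨y, fun i j ↦ le_antisymm (hle j i) (hle i j)⟩

end Radon

/-- Closed sets indexed by `ι` with empty intersection in a space of dimension at most `#ι - 2`
admit functions, the one attached to each set never maximal on it, that are nowhere all equal. -/
lemma exists_continuous_forall_not_forall_eq {ι E : Type*} [Fintype ι] [NormedAddCommGroup E]
    [NormedSpace ℝ E] [FiniteDimensional ℝ E] (hcard : Module.finrank ℝ E + 2 ≤ Fintype.card ι)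
    {K : ι → Set E} (hK : ∀ i, IsClosed (K i)) (hempty : ⋂ i, K i = ∅) :
    ∃ g : ι → E → ℝ, (∀ i, Continuous (g i)) ∧ (∀ i, ∀ x ∈ K i, ∃ j, g i x < g j x) ∧
      ¬ ∃ y, ∀ i j, g i y = g j y := by
  choose f hfK hf hf01 using fun i ↦ (hK i).isOpen_compl.exists_contDiff_support_eq (n := 1)
  have hf0 (i : ι) (x : E) : 0 ≤ f i x := (hf01 i ⟨x, rfl⟩).1
  have hfpos (x : E) : ∃ i, 0 < f i x := by
    by_contra! h
    have : x ∈ ⋂ i, K i := Set.mem_iInter.2 fun i ↦ by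
      by_contra hx
      have : x ∈ Function.support (f i) := hfK i ▸ hx
      exact this (le_antisymm (h i) (hf0 i x))
    simp [hempty] at this
  have hfzero (i : ι) (x : E) (hx : x ∈ K i) : f i x = 0 := by
    by_contra h
    have : x ∈ (K i)ᶜ := hfK i ▸ h
    exact this hx
  have hG : ContDiff ℝ 1 fun (p : E × ℝ) (i : ι) ↦ p.2 * f i p.1 :=
    contDiff_pi.2 fun i ↦ contDiff_snd.mul ((hf i).comp contDiff_fst)
  have hdense := hG.dense_compl_range_of_finrank_lt_finrank (by simp; omega)
  obtain ⟨w, hwpos, hw⟩ := hdense.inter_open_nonempty (Set.pi Set.univ fun _ : ι ↦ Set.Ioi 0)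
    (isOpen_set_pi Set.finite_univ fun _ _ ↦ isOpen_Ioi) ⟨1, by simp⟩
  have hwpos (i : ι) : 0 < w i := hwpos i trivial
  refine ⟨fun i x ↦ f i x / w i, fun i ↦ (hf i).continuous.div_const _, fun i x hx ↦ ?_, ?_⟩
  · obtain ⟨j, hj⟩ := hfpos x
    exact ⟨j, by simpa [hfzero i x hx] using div_pos hj (hwpos j)⟩
  · rintro ⟨y, hy⟩
    obtain ⟨j, hj⟩ := hfpos y
    refine hw ⟨(y, w j / f j y), funext fun i ↦ ?_⟩
    have := hy i j
    rw [div_eq_div_iff (hwpos i).ne' (hwpos j).ne'] at this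
    simp only
    field_simp
    linarith

section Radon

variable {ι E : Type*} [DecidableEq ι] [Fintype ι] [NormedAddCommGroup E] [NormedSpace ℝ E]
  [FiniteDimensional ℝ E]

/-- If the proper faces of a simplex with at least `dim E + 2` vertices are mapped compatibly to
singular chains in `E`, with the face `s` going to a chain in the intersection of the `A i`,
`i ∉ s`, then all the `A i` have a common point. -/
lemma IsBoundaryChainMap.nonempty_iInter (hcard : Module.finrank ℝ E + 2 ≤ Fintype.card ι)
    {γ : Finset ι → SingularChain E} (hγ : IsBoundaryChainMap γ) {A : ι → Set E}
    (hmem : ∀ s, s ≠ Finset.univ → γ s ∈ SingularChain.chainsIn (⋂ i ∉ s, A i) s.card) :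
    (⋂ i, A i).Nonempty := by
  have : Nonempty ι := Fintype.card_pos_iff.1 (by omega)
  have : ProperSpace E := FiniteDimensional.proper ℝ E
  let C (s : Finset ι) : Set E := ⋃ σ ∈ (γ s).support, Set.range σ.2
  have hC (s) : IsCompact (C s) := (γ s).support.isCompact_biUnion fun σ _ ↦ by
    have : CompactSpace (stdSimplex ℝ (Fin σ.1)) :=
      isCompact_iff_compactSpace.1 (isCompact_stdSimplex _ _)
    exact isCompact_range σ.2.continuous
  have hCmem (s) (hs : s ≠ Finset.univ) : γ s ∈ SingularChain.chainsIn (C s) s.card :=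
    fun σ hσ ↦ ⟨(hmem s hs hσ).1, fun p ↦ Set.mem_biUnion hσ ⟨p, rfl⟩⟩
  have hCA (s) (hs : s ≠ Finset.univ) (i) (hi : i ∉ s) : C s ⊆ A i := by
    refine Set.iUnion₂_subset fun σ hσ ↦ ?_
    rintro _ ⟨p, rfl⟩
    exact Set.mem_iInter₂.1 ((hmem s hs hσ).2 p) i hi
  let K (i : ι) : Set E := ⋃ s ∈ Finset.univ.filter (i ∉ ·), C s
  have hK (i) : IsClosed (K i) := isClosed_biUnion_finset fun s _ ↦ (hC s).isClosed
  have hKA (i) : K i ⊆ A i := by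
    refine Set.iUnion₂_subset fun s hs ↦ ?_
    have hi : i ∉ s := by simpa using hs
    exact hCA s (fun h ↦ hi (h ▸ Finset.mem_univ i)) i hi
  by_contra h
  have hempty : ⋂ i, K i = ∅ :=
    Set.subset_eq_empty (Set.iInter_mono hKA) (Set.not_nonempty_iff_eq_empty.1 h)
  obtain ⟨g, hg, hgK, hne⟩ := exists_continuous_forall_not_forall_eq hcard hK hempty
  exact hne (hγ.exists_forall_eq C hCmem (fun s ↦ (hC s).isBounded) hg
    fun s _ x hx i hi ↦ hgK i x (Set.mem_biUnion (by simpa using hi) hx))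

end Radon

namespace SingularChain

variable {X : Type*} [TopologicalSpace X]

/-- Every singular cycle of `A` with `m` vertices in each simplex is a boundary in `A`. -/
def IsAcyclicAt (A : Set X) (m : ℕ) : Prop :=
  ∀ c ∈ chainsIn A m, boundary c = 0 → ∃ c' ∈ chainsIn A (m + 1), boundary c' = c

/-- Acyclic carriers: chains can be filled in by induction on the dimension of the faces. -/
lemma exists_isBoundaryChainMap {ι : Type*} [DecidableEq ι] [Fintype ι] [Nonempty ι]
    {B : Finset ι → Set X} (hB : Monotone B)
    (hac : ∀ s : Finset ι, s ≠ Finset.univ → ∀ m, s.card = m + 1 → IsAcyclicAt (B s) m) :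
    ∃ γ : Finset ι → SingularChain X, IsBoundaryChainMap γ ∧
      ∀ s, s ≠ Finset.univ → γ s ∈ chainsIn (B s) s.card := by
  have key (n : ℕ) : ∃ γ : Finset ι → SingularChain X,
      (∃ σ, γ ∅ = Finsupp.single ⟨0, σ⟩ 1) ∧
      (∀ s, s ≠ ∅ → s ≠ Finset.univ → s.card ≤ n →
        boundary (γ s) = ∑ i ∈ s, γ (s.erase i)) ∧
      ∀ s, s ≠ Finset.univ → s.card ≤ n → γ s ∈ chainsIn (B s) s.card := by
    induction n with
    | zero =>
      let σ : C(stdSimplex ℝ (Fin 0), X) :=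
        ⟨isEmptyElim, continuous_of_const isEmptyElim⟩
      refine ⟨fun _ ↦ Finsupp.single ⟨0, σ⟩ 1, ⟨σ, rfl⟩, fun s h0 _ h ↦ ?_, fun s _ h ↦ ?_⟩
      · exact absurd (by simpa using h) h0
      · exact Finsupp.single_mem_supported _ _ ⟨(Nat.le_zero.1 h).symm, fun p ↦ isEmptyElim p⟩
    | succ n ih =>
      obtain ⟨γ, h0, hb, hm⟩ := ih
      have hfill (s : Finset ι) (hs : s ≠ Finset.univ) (hn : s.card = n + 1) :
          ∃ c ∈ chainsIn (B s) (n + 1), boundary c = ∑ i ∈ s, γ (s.erase i) := by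
        have hcard (i) (hi : i ∈ s) : (s.erase i).card = n := by
          rw [Finset.card_erase_of_mem hi, hn]; rfl
        have hne (i) (hi : i ∈ s) : s.erase i ≠ Finset.univ :=
          fun h ↦ Finset.notMem_erase i s (h ▸ Finset.mem_univ i)
        refine hac s hs n hn _ (sum_mem fun i hi ↦ ?_) ?_
        · rw [← hcard i hi]
          exact chainsIn_mono (hB (Finset.erase_subset i s)) _ (hm _ (hne i hi) (hcard i hi).le)
        · rw [map_sum]
          rcases n with _ | n
          · refine Finset.sum_eq_zero fun i hi ↦ ?_
            obtain ⟨σ, hσ⟩ := h0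
            rw [Finset.card_eq_zero.1 (hcard i hi), hσ, boundary_single, simplexBoundary]
          · rw [Finset.sum_congr rfl fun i hi ↦
              hb _ (Finset.card_pos.1 (by simp [hcard i hi])).ne_empty (hne i hi) (hcard i hi).le]
            exact Finset.sum_sum_erase_erase γ s
      choose! F hF hFb using hfill
      let γ' (s : Finset ι) : SingularChain X := if s.card = n + 1 then F s else γ s
      have hγ' (s) (hs : s.card ≤ n) : γ' s = γ s := if_neg (by omega)
      refine ⟨γ', by rwa [hγ' ∅ (by simp)], fun s hs0 hs hn ↦ ?_, fun s hs hn ↦ ?_⟩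
      · have h (i) (hi : i ∈ s) : γ' (s.erase i) = γ (s.erase i) :=
          hγ' _ (by rw [Finset.card_erase_of_mem hi]; omega)
        rw [Finset.sum_congr rfl h]
        rcases hn.eq_or_lt with hn | hn
        · rw [← hFb s hs hn]
          exact congrArg _ (if_pos hn)
        · rw [hγ' s (by omega)]
          exact hb s hs0 hs (by omega)
      · rcases hn.eq_or_lt with hn | hn
        · rw [hn]
          simpa only [γ', if_pos hn] using hF s hs hn
        · rw [hγ' s (by omega)]
          exact hm s hs (by omega)
  obtain ⟨γ, h0, hb, hm⟩ := key (Fintype.card ι)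
  exact ⟨γ, ⟨h0, fun s h h' ↦ hb s h h' s.card_le_univ⟩, fun s h ↦ hm s h s.card_le_univ⟩

end SingularChain

namespace SingularChain

section Bridge

open CategoryTheory AlgebraicTopology Opposite Simplicial

variable {X : Type} [TopologicalSpace X]

/-- The simplex of the space `X` defined by a simplex of the singular set of `A ⊆ X`. -/
noncomputable def simplexOfSSet (A : Set X) (n : ℕ)
    (s : (TopCat.toSSet.obj (TopCat.of A)).obj (op ⦋n⦌)) :
    Σ m : ℕ, C(stdSimplex ℝ (Fin m), X) :=
  ⟨n + 1, ContinuousMap.comp ⟨Subtype.val, continuous_subtype_val⟩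
    (TopCat.toSSetObjEquiv (TopCat.of A) (op ⦋n⦌) s)⟩

lemma simplexOfSSet_injective (A : Set X) (n : ℕ) :
    Function.Injective (simplexOfSSet A n) := by
  intro s t h
  refine (TopCat.toSSetObjEquiv (TopCat.of A) (op ⦋n⦌)).injective ?_
  refine ContinuousMap.ext fun p ↦ Subtype.ext ?_
  exact DFunLike.congr_fun (eq_of_heq (Sigma.mk.inj h).2) p

lemma range_simplexOfSSet (A : Set X) (n : ℕ) :
    Set.range (simplexOfSSet A n) = {σ | σ.1 = n + 1 ∧ ∀ p, σ.2 p ∈ A} := by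
  ext σ
  constructor
  · rintro ⟨s, rfl⟩
    exact ⟨rfl, fun p ↦ (TopCat.toSSetObjEquiv (TopCat.of A) (op ⦋n⦌) s p).2⟩
  · obtain ⟨_, σ⟩ := σ
    rintro ⟨rfl, hσ⟩
    refine ⟨(TopCat.toSSetObjEquiv (TopCat.of A) (op ⦋n⦌)).symm
      ⟨fun p ↦ ⟨σ p, hσ p⟩, σ.continuous.subtype_mk hσ⟩, ?_⟩
    rw [simplexOfSSet, Equiv.apply_symm_apply]
    rfl

/-- The chain complex whose homology is `SingularHomology (ZMod 2) A`. -/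
noncomputable abbrev singularComplex (A : Set X) : ChainComplex (ModuleCat (ZMod 2)) ℕ :=
  (alternatingFaceMapComplex (ModuleCat (ZMod 2))).obj
    (((SimplicialObject.whiskering _ _).obj (ModuleCat.free (ZMod 2))).obj
      (TopCat.toSSet.obj (TopCat.of A)))

/-- The inclusion of the singular chain complex of `A ⊆ X`. -/
noncomputable def ofComplex (A : Set X) (n : ℕ) :
    (singularComplex A).X n →ₗ[ZMod 2] SingularChain X :=
  Finsupp.lmapDomain (ZMod 2) (ZMod 2) (simplexOfSSet A n)

lemma ofComplex_injective (A : Set X) (n : ℕ) : Function.Injective (ofComplex A n) :=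
  Finsupp.mapDomain_injective (simplexOfSSet_injective A n)

lemma range_ofComplex (A : Set X) (n : ℕ) :
    LinearMap.range (ofComplex A n) = chainsIn A (n + 1) := by
  rw [chainsIn, ← range_simplexOfSSet, ← Set.image_univ, ← Finsupp.lmapDomain_supported,
    Finsupp.supported_univ, Submodule.map_top]
  rfl

lemma ofComplex_d (A : Set X) (n : ℕ) (c : (singularComplex A).X (n + 1)) :
    ofComplex A n (((singularComplex A).d (n + 1) n).hom c) = boundary (ofComplex A (n + 1) c) := by
  have h : ofComplex A n ∘ₗ ((singularComplex A).d (n + 1) n).hom =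
      boundary ∘ₗ ofComplex A (n + 1) := by
    refine Finsupp.lhom_ext' fun s ↦ LinearMap.ext_ring ?_
    have hs : ofComplex A (n + 1) (Finsupp.single s 1) =
        Finsupp.single (simplexOfSSet A (n + 1) s) 1 := Finsupp.mapDomain_single
    have hδ (i : Fin (n + 2)) :
        ofComplex A n (((((SimplicialObject.whiskering _ _).obj (ModuleCat.free (ZMod 2))).obj
          (TopCat.toSSet.obj (TopCat.of A))).δ i).hom (Finsupp.single s 1)) =
        Finsupp.single ⟨n + 1, (simplexOfSSet A (n + 1) s).2.comp (facet i)⟩ 1 := by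
      refine (congrArg (ofComplex A n) (Finsupp.mapDomain_single)).trans ?_
      exact Finsupp.mapDomain_single
    have hsign (i : Fin (n + 2)) (c : SingularChain X) : (-1 : ℤ) ^ (i : ℕ) • c = c := by
      rcases neg_one_pow_eq_or ℤ (i : ℕ) with h | h <;> simp [h, ZModModule.neg_eq_self]
    let x : (singularComplex A).X (n + 1) := Finsupp.single s 1
    change ofComplex A n (((singularComplex A).d (n + 1) n).hom x) = boundary (ofComplex A (n + 1) x)
    rw [hs, boundary_single, alternatingFaceMapComplex_obj_d, AlternatingFaceMapComplex.objD,
      ModuleCat.hom_sum, LinearMap.sum_apply, map_sum]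
    refine Finset.sum_congr rfl fun i _ ↦ ?_
    rw [ModuleCat.hom_zsmul, LinearMap.smul_apply, map_zsmul, hsign]
    exact hδ i
  exact LinearMap.congr_fun h c

lemma isAcyclicAt_of_subsingleton {A : Set X} {n : ℕ}
    (h : Subsingleton ((singularComplex A).homology (n + 1))) : IsAcyclicAt A (n + 2) := by
  have hex := (HomologicalComplex.exactAt_iff_isZero_homology _ _).2
    (ModuleCat.isZero_of_subsingleton ((singularComplex A).homology (n + 1)))
  rw [HomologicalComplex.exactAt_iff' _ (n + 2) (n + 1) n (by simp) (by simp),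
    ShortComplex.moduleCat_exact_iff] at hex
  replace hex : ∀ c : (singularComplex A).X (n + 1), ((singularComplex A).d (n + 1) n).hom c = 0 →
    ∃ c', ((singularComplex A).d (n + 2) (n + 1)).hom c' = c := hex
  intro c hc hbc
  rw [← range_ofComplex] at hc
  obtain ⟨c, rfl⟩ := hc
  obtain ⟨c', rfl⟩ := hex c (ofComplex_injective A n (by rw [ofComplex_d, hbc, map_zero]))
  refine ⟨ofComplex A (n + 2) c', ?_, (ofComplex_d A (n + 1) c').symm⟩
  rw [← range_ofComplex]
  exact ⟨c', rfl⟩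

end Bridge

end SingularChain

namespace SingularChain

section LowDegree

variable {X : Type*} [TopologicalSpace X]

lemma simplexBoundary_one (σ : C(stdSimplex ℝ (Fin 1), X)) (τ : C(stdSimplex ℝ (Fin 0), X)) :
    simplexBoundary ⟨1, σ⟩ = Finsupp.single ⟨0, τ⟩ 1 := by
  rw [simplexBoundary, Fin.sum_univ_one, Subsingleton.elim (σ.comp (facet 0)) τ]

lemma boundary_boundary_of_mem_chainsIn_two {A : Set X} {c : SingularChain X}
    (hc : c ∈ chainsIn A 2) : boundary (boundary c) = 0 := by
  refine Finsupp.map_mem_of_mem_supported (boundary ∘ₗ boundary) (T := ⊥) ?_ hc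
  rintro ⟨_, σ⟩ ⟨rfl, -⟩
  let τ : C(stdSimplex ℝ (Fin 0), X) := ⟨isEmptyElim, continuous_of_const isEmptyElim⟩
  rw [LinearMap.comp_apply, boundary_single, simplexBoundary, Fin.sum_univ_two, map_add,
    boundary_single, boundary_single, simplexBoundary_one _ τ, simplexBoundary_one _ τ]
  exact ZModModule.add_self _

lemma isAcyclicAt_zero {A : Set X} (hA : A.Nonempty) : IsAcyclicAt A 0 := by
  obtain ⟨a, ha⟩ := hA
  intro c hc _
  have : c ∈ (chainsIn A 1).map boundary := by
    refine Finsupp.map_mem_of_mem_supported LinearMap.id ?_ hc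
    rintro ⟨_, σ⟩ ⟨rfl, -⟩
    refine ⟨Finsupp.single ⟨1, .const _ a⟩ 1,
      Finsupp.single_mem_supported _ _ ⟨rfl, fun _ ↦ ha⟩, ?_⟩
    rw [boundary_single, simplexBoundary_one _ σ, LinearMap.id_apply]
  exact this

lemma isAcyclicAt_one {A : Set X} (hA : IsPathConnected A) : IsAcyclicAt A 1 := by
  obtain ⟨a, ha, hjoin⟩ := hA
  let a₁ : Σ m : ℕ, C(stdSimplex ℝ (Fin m), X) := ⟨1, .const _ a⟩
  intro c hc hbc
  have : c ∈ (chainsIn A 2).map boundary ⊔ Submodule.span (ZMod 2) {Finsupp.single a₁ 1} := by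
    refine Finsupp.map_mem_of_mem_supported LinearMap.id ?_ hc
    rintro ⟨_, σ⟩ ⟨rfl, hσ⟩
    let p₀ : stdSimplex ℝ (Fin 1) := default
    obtain ⟨γ, hγ⟩ := hjoin (hσ p₀)
    let τ : C(stdSimplex ℝ (Fin 2), X) :=
      γ.toContinuousMap.comp (stdSimplexHomeomorphUnitInterval : C(_, _))
    have hface (i : Fin 2) : facet i p₀ = stdSimplex.vertex (S := ℝ) (i.succAbove 0) := by
      rw [Subsingleton.elim p₀ (stdSimplex.vertex 0)]
      exact stdSimplex.map_vertex _ _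
    have h0 : τ.comp (facet 0) = σ := by
      ext p
      rw [Subsingleton.elim p p₀, ContinuousMap.comp_apply, hface]
      exact (congrArg γ stdSimplexHomeomorphUnitInterval_one).trans γ.target
    have h1 : τ.comp (facet 1) = .const _ a := by
      ext p
      rw [Subsingleton.elim p p₀, ContinuousMap.comp_apply, hface]
      exact (congrArg γ stdSimplexHomeomorphUnitInterval_zero).trans γ.source
    refine Submodule.mem_sup.2 ⟨_, ⟨Finsupp.single ⟨2, τ⟩ 1,
      Finsupp.single_mem_supported _ _ ⟨rfl, fun p ↦ hγ _⟩, rfl⟩, _,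
      Submodule.mem_span_singleton_self _, ?_⟩
    rw [boundary_single, simplexBoundary, Fin.sum_univ_two, h0, h1, add_assoc,
      ZModModule.add_self, add_zero, LinearMap.id_apply]
  obtain ⟨_, ⟨c', hc', rfl⟩, _, ha₁, rfl⟩ := Submodule.mem_sup.1 this
  obtain ⟨k, rfl⟩ := Submodule.mem_span_singleton.1 ha₁
  refine ⟨c', hc', ?_⟩
  let τ : C(stdSimplex ℝ (Fin 0), X) := ⟨isEmptyElim, continuous_of_const isEmptyElim⟩
  have hk : k = 0 := by
    rw [map_add, boundary_boundary_of_mem_chainsIn_two hc', zero_add, map_smul, boundary_single,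
      simplexBoundary_one _ τ] at hbc
    simpa using hbc
  simp [hk]

end LowDegree

end SingularChain

section Helly

/-- The acyclicity assumption of the Helly-type theorem, in terms of singular chains. -/
lemma SingularChain.isAcyclicAt_of_singularHomology {X : Type} [TopologicalSpace X] {d : ℕ}
    {A : Set X} (hA : IsPathConnected A)
    (h : ∀ i, 1 ≤ i → i ≤ d - 1 → Subsingleton (SingularHomology (ZMod 2) A i))
    {m : ℕ} (hm : m ≤ d) : IsAcyclicAt A m := by
  rcases m with _ | _ | m
  · exact isAcyclicAt_zero hA.nonempty
  · exact isAcyclicAt_one hA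
  · exact isAcyclicAt_of_subsingleton (h (m + 1) (by omega) (by omega))

lemma nonempty_iInter_of_isAcyclicAt {ι E : Type*} [Fintype ι] [NormedAddCommGroup E]
    [NormedSpace ℝ E] [FiniteDimensional ℝ E] (hcard : Module.finrank ℝ E + 2 ≤ Fintype.card ι)
    {A : ι → Set E} (hac : ∀ s : Finset ι, s ≠ Finset.univ → ∀ m, s.card = m + 1 →
      SingularChain.IsAcyclicAt (⋂ i ∉ s, A i) m) :
    (⋂ i, A i).Nonempty := by
  classical
  have : Nonempty ι := Fintype.card_pos_iff.1 (by omega)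
  obtain ⟨γ, hγ, hmem⟩ := SingularChain.exists_isBoundaryChainMap (B := fun s ↦ ⋂ i ∉ s, A i)
    (fun s t hst ↦ Set.biInter_mono (fun i hi his ↦ hi (hst his)) fun _ _ ↦ subset_rfl) hac
  exact hγ.nonempty_iInter hcard hmem

/-- Helly's argument: if each family of at most `n + 1` sets has a common point, then a lemma of
Radon type for `n + 2` sets gives a common point of any finite family. -/
lemma nonempty_sInter_of_forall_card_le.{u} {E : Type u} {n : ℕ} {ℱ : Finset (Set E)}
    {P : ℕ → Set E → Prop}
    (hP : ∀ 𝒢 ⊆ ℱ, 𝒢.Nonempty → (⋂₀ (𝒢 : Set (Set E))).Nonempty → ∀ m ≤ n, P m (⋂₀ 𝒢))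
    (hradon : ∀ (ι : Type u) [Fintype ι] (A : ι → Set E), Fintype.card ι = n + 2 →
      (∀ s : Finset ι, s ≠ Finset.univ → ∀ m, s.card = m + 1 → P m (⋂ i ∉ s, A i)) →
      (⋂ i, A i).Nonempty)
    (hsmall : ∀ 𝒢 ⊆ ℱ, 𝒢.card ≤ n + 1 → (⋂₀ (𝒢 : Set (Set E))).Nonempty) :
    (⋂₀ (ℱ : Set (Set E))).Nonempty := by
  classical
  suffices h : ∀ k, ∀ 𝒢 ⊆ ℱ, 𝒢.card ≤ k → (⋂₀ (𝒢 : Set (Set E))).Nonempty from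
    h _ ℱ subset_rfl le_rfl
  intro k
  induction k with
  | zero => exact fun 𝒢 h𝒢 hk ↦ hsmall 𝒢 h𝒢 (by omega)
  | succ k ih =>
    intro 𝒢 h𝒢 hk
    by_cases hn : 𝒢.card ≤ n + 1
    · exact hsmall 𝒢 h𝒢 hn
    obtain ⟨t, ht, htn⟩ := Finset.exists_subset_card_eq (by omega : n + 2 ≤ 𝒢.card)
    refine (hradon t (fun F ↦ F.1 ∩ ⋂₀ ((𝒢 \ t : Finset (Set E)) : Set (Set E)))
      (by simpa using htn) fun s hs m hm ↦ ?_).mono ?_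
    · obtain ⟨F₀, hF₀⟩ : ∃ F, F ∉ s :=
        not_forall.1 fun h ↦ hs (Finset.eq_univ_iff_forall.2 h)
      have hF₀𝒢 : F₀.1 ∈ 𝒢 \ s.map (.subtype _) := by simp [ht F₀.2, hF₀]
      have heq : ⋂ F ∉ s, (F.1 ∩ ⋂₀ ((𝒢 \ t : Finset (Set E)) : Set (Set E))) =
          ⋂₀ ((𝒢 \ s.map (.subtype _) : Finset (Set E)) : Set (Set E)) := by
        ext x
        simp only [Set.mem_iInter, Set.mem_inter_iff, Set.mem_sInter, Finset.mem_coe,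
          Finset.mem_sdiff, Finset.mem_map, Function.Embedding.subtype_apply]
        constructor
        · rintro h F ⟨hF, hFs⟩
          by_cases hFt : F ∈ t
          · exact (h ⟨F, hFt⟩ fun hF ↦ hFs ⟨_, hF, rfl⟩).1
          · exact (h F₀ hF₀).2 F ⟨hF, hFt⟩
        · intro h F hF
          refine ⟨h F ⟨ht F.2, ?_⟩, fun G ⟨hG, hGt⟩ ↦ h G ⟨hG, ?_⟩⟩
          · rintro ⟨F', hF', hFF'⟩
            exact hF (Subtype.ext hFF' ▸ hF')
          · rintro ⟨F', -, rfl⟩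
            exact hGt F'.2
      have hsub : s.map (.subtype _) ⊆ 𝒢 := fun F hF ↦ by
        obtain ⟨F', -, rfl⟩ := Finset.mem_map.1 hF
        exact ht F'.2
      have hsc : s.card ≤ n + 2 := by simpa [htn] using s.card_le_univ
      have hsc' : s.card ≠ n + 2 := fun h ↦ hs ((Finset.card_eq_iff_eq_univ s).1 (by simpa [htn]))
      rw [heq]
      refine hP _ (Finset.sdiff_subset.trans h𝒢) ⟨_, hF₀𝒢⟩
        (ih _ (Finset.sdiff_subset.trans h𝒢) ?_) m (by omega)
      rw [Finset.card_sdiff_of_subset hsub, Finset.card_map]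
      omega
    · intro x hx F hF
      rw [Set.mem_iInter] at hx
      by_cases hFt : F ∈ t
      · exact (hx ⟨F, hFt⟩).1
      · obtain ⟨F₀, hF₀⟩ : t.Nonempty := Finset.card_pos.1 (by omega)
        exact (hx ⟨F₀, hF₀⟩).2 F (Finset.mem_sdiff.2 ⟨hF, hFt⟩)

end Helly

/-- **Sharp homological Helly-type theorem** (Goaoc, Paták, Patáková, Tancer, Wagner).
Let `d ≥ 1` and let `ℱ` be a finite family of subsets of `ℝ^d` such that the intersection
of every nonempty subfamily is either empty, or path-connected with vanishing `ℤ₂`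
singular homology in all degrees `1 ≤ i ≤ d − 1`. Then `⋂ℱ = ∅` iff some subfamily with
at most `d + 1` members has empty intersection. -/
theorem helly_from_homological_radon
    (d : ℕ) (hd : 1 ≤ d)
    (ℱ : Finset (Set (Fin d → ℝ)))
    (hgood : ∀ ℱ' : Finset (Set (Fin d → ℝ)), ℱ' ⊆ ℱ → ℱ'.Nonempty →
      ⋂₀ (ℱ' : Set (Set (Fin d → ℝ))) = ∅ ∨
        (IsPathConnected (⋂₀ (ℱ' : Set (Set (Fin d → ℝ)))) ∧
          ∀ i : ℕ, 1 ≤ i → i ≤ d - 1 →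
            Subsingleton (SingularHomology (ZMod 2)
              ↥(⋂₀ (ℱ' : Set (Set (Fin d → ℝ)))) i))) :
    ⋂₀ (ℱ : Set (Set (Fin d → ℝ))) = ∅ ↔
      ∃ 𝒢 ⊆ ℱ, 𝒢.card ≤ d + 1 ∧ ⋂₀ (𝒢 : Set (Set (Fin d → ℝ))) = ∅ := by
  refine ⟨fun h ↦ ?_, ?_⟩
  · by_contra! hsmall
    refine (nonempty_sInter_of_forall_card_le (n := d)
      (P := fun m A ↦ SingularChain.IsAcyclicAt A m)
      (fun 𝒢 h𝒢 hne hinter m hm ↦ ?_)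
      (fun ι _ A hι hac ↦ nonempty_iInter_of_isAcyclicAt (by simp [hι]) hac) hsmall).ne_empty h
    obtain ⟨hpath, hhom⟩ := (hgood 𝒢 h𝒢 hne).resolve_left hinter.ne_empty
    exact SingularChain.isAcyclicAt_of_singularHomology hpath hhom hm
  · rintro ⟨𝒢, h𝒢, -, h⟩
    exact Set.subset_eq_empty (Set.sInter_subset_sInter (Finset.coe_subset.2 h𝒢)) h
end

section
/- Let d ≥ 1 be an integer and let ℱ be a finite family of subsets of ℝ^d such that for every nonempty subfamily ℱ' ⊆ ℱ the intersection ⋂ℱ' is either empty, or it is path-connected and the singular homology H_i(⋂ℱ'; ℤ₂) vanishes for all 1 ≤ i ≤ ⌈d/2⌉−1. Then ⋂ℱ = ∅ if and only if there exists a subfamily 𝒢 ⊆ ℱ with at most d+2 elements and ⋂𝒢 = ∅. -/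
open CategoryTheory AlgebraicTopology

namespace VanKampenFlores

/-- The mod 2 coboundary of a function on finite sequences. -/
def coboundary {α : Type*} : (List α → ZMod 2) → List α → ZMod 2
  | _, [] => 0
  | φ, x :: xs => φ xs + coboundary (fun l => φ (x :: l)) xs

section Coboundary

variable {α : Type*}

@[simp] lemma coboundary_nil (φ : List α → ZMod 2) : coboundary φ [] = 0 := rfl

lemma coboundary_cons (φ : List α → ZMod 2) (x : α) (xs : List α) :
    coboundary φ (x :: xs) = φ xs + coboundary (fun l => φ (x :: l)) xs := rfl

lemma coboundary_add (φ ψ : List α → ZMod 2) (l : List α) :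
    coboundary (fun l => φ l + ψ l) l = coboundary φ l + coboundary ψ l := by
  induction l generalizing φ ψ with
  | nil => simp
  | cons x xs ih => simp only [coboundary_cons, ih]; ring

lemma coboundary_zero (l : List α) : coboundary (fun _ => 0) l = 0 := by
  induction l with
  | nil => simp
  | cons x xs ih => simp only [coboundary_cons, ih]; ring

lemma coboundary_indicator_nil (P : Prop) [Decidable P] (c : ZMod 2) (l : List α) :
    coboundary (fun l => if l = [] ∧ P then c else 0) l =
      if l.length = 1 ∧ P then c else 0 := by
  cases l with
  | nil => simp
  | cons x xs => simp [coboundary_cons, coboundary_zero]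

lemma coboundary_indicator_nil' (P : Prop) [Decidable P] (c : ZMod 2) (l : List α) :
    coboundary (fun l => if P ∧ l = [] then c else 0) l =
      if P ∧ l.length = 1 then c else 0 := by
  simpa only [and_comm] using coboundary_indicator_nil P c l

/-- The sum of the values of a function over all shuffles (maximal chains in the product)
of two sequences. -/
def shuffleSum {α β : Type*} : (List (α × β) → ZMod 2) → List α → List β → ZMod 2
  | _, [], _ => 0
  | _, _ :: _, [] => 0
  | φ, x :: xs, y :: ys =>
      shuffleSum (fun l => φ ((x, y) :: l)) xs (y :: ys) +
        shuffleSum (fun l => φ ((x, y) :: l)) (x :: xs) ys +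
        if xs = [] ∧ ys = [] then φ [(x, y)] else 0
  termination_by _ a b => a.length + b.length

variable {β : Type*}

@[simp] lemma shuffleSum_nil_left (φ : List (α × β) → ZMod 2) (b : List β) :
    shuffleSum φ [] b = 0 := by rw [shuffleSum]

@[simp] lemma shuffleSum_nil_right (φ : List (α × β) → ZMod 2) (a : List α) :
    shuffleSum φ a [] = 0 := by cases a <;> rw [shuffleSum]

lemma shuffleSum_cons (φ : List (α × β) → ZMod 2) (x : α) (xs : List α) (y : β) (ys : List β) :
    shuffleSum φ (x :: xs) (y :: ys) =
      shuffleSum (fun l => φ ((x, y) :: l)) xs (y :: ys) +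
        shuffleSum (fun l => φ ((x, y) :: l)) (x :: xs) ys +
        if xs = [] ∧ ys = [] then φ [(x, y)] else 0 := by rw [shuffleSum]

lemma shuffleSum_add (φ ψ : List (α × β) → ZMod 2) (a : List α) (b : List β) :
    shuffleSum (fun l => φ l + ψ l) a b = shuffleSum φ a b + shuffleSum ψ a b := by
  fun_induction shuffleSum φ a b generalizing ψ with
  | case1 => simp
  | case2 => simp
  | case3 φ x xs y ys ih₁ ih₂ =>
    rw [shuffleSum_cons, ih₁, ih₂, shuffleSum_cons ψ]
    split_ifs <;> ring

lemma shuffleSum_congr (φ ψ : List (α × β) → ZMod 2) (a : List α) (b : List β)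
    (h : ∀ l : List (α × β), (∀ p ∈ l, p.1 ∈ a ∧ p.2 ∈ b) → l.length + 1 = a.length + b.length →
      φ l = ψ l) : shuffleSum φ a b = shuffleSum ψ a b := by
  fun_induction shuffleSum φ a b generalizing ψ with
  | case1 => simp
  | case2 => simp
  | case3 φ x xs y ys ih₁ ih₂ =>
    rw [shuffleSum_cons ψ, ih₁ (fun l => ψ ((x, y) :: l)), ih₂ (fun l => ψ ((x, y) :: l))]
    · congr 1
      split_ifs with h'
      · obtain ⟨rfl, rfl⟩ := h'
        exact h _ (by simp) (by simp)
      · rfl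
    · intro l hl hlen
      refine h _ ?_ (by simp at hlen ⊢; omega)
      simp only [List.mem_cons, forall_eq_or_imp, true_or, and_self, true_and] at hl ⊢
      exact fun p hp => ⟨(hl p hp).1, .inr (hl p hp).2⟩
    · intro l hl hlen
      refine h _ ?_ (by simp at hlen ⊢; omega)
      simp only [List.mem_cons, forall_eq_or_imp, true_or, and_self, true_and] at hl ⊢
      exact fun p hp => ⟨.inr (hl p hp).1, (hl p hp).2⟩

lemma shuffleSum_swap (φ : List (α × β) → ZMod 2) (a : List α) (b : List β) :
    shuffleSum (fun l => φ (l.map Prod.swap)) b a = shuffleSum φ a b := by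
  fun_induction shuffleSum φ a b with
  | case1 => simp
  | case2 => simp
  | case3 φ x xs y ys ih₁ ih₂ =>
    rw [shuffleSum_cons, ← ih₁, ← ih₂, add_comm (shuffleSum _ ys _)]
    simp [and_comm]

lemma shuffleSum_coboundary (φ : List (α × β) → ZMod 2) (a : List α) (b : List β) :
    shuffleSum (coboundary φ) a b =
      coboundary (fun a' => shuffleSum φ a' b) a + coboundary (fun b' => shuffleSum φ a b') b +
        if a.length = 1 ∧ b.length = 1 then φ [] else 0 := by
  fun_induction shuffleSum φ a b with
  | case1 => simp [coboundary_zero]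
  | case2 => simp [coboundary_zero]
  | case3 φ x xs y ys ih₁ ih₂ =>
    rw [shuffleSum_cons]
    simp only [coboundary_cons, shuffleSum_add, shuffleSum_cons, ih₁, ih₂, coboundary_add,
      coboundary_indicator_nil, coboundary_indicator_nil', coboundary_nil, List.length_cons,
      Nat.add_eq_right, List.length_eq_zero_iff]
    generalize (if xs.length = 1 ∧ ys = [] then φ [(x, y)] else 0) = u
    generalize (if xs = [] ∧ ys.length = 1 then φ [(x, y)] else 0) = v
    rw [add_zero]
    linear_combination (CharTwo.add_self_eq_zero (shuffleSum (fun l => φ ((x, y) :: l)) xs ys))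

end Coboundary

section Labels

variable {ι : Type*} [LinearOrder ι]

/-- Ky Fan's alternating cochain: a multiset of signed labels is counted if its labels are
pairwise distinct in absolute value and, listed by increasing absolute value, have alternating
signs beginning with `true`. -/
def alternating (M : Multiset (ι × Bool)) : ZMod 2 :=
  if (M.map Prod.fst).Nodup ∧ ∀ l ∈ M, l.2 = decide (Even (M.countP (·.1 < l.1))) then 1 else 0

/-- The sum of the values of a function over all multisets obtained by erasing one element. -/
def eraseSum {α : Type*} [DecidableEq α] (F : Multiset α → ZMod 2) (M : Multiset α) : ZMod 2 :=
  (M.map fun l => F (M.erase l)).sum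

lemma eraseSum_cons {α : Type*} [DecidableEq α] (F : Multiset α → ZMod 2) (l : α)
    (M : Multiset α) :
    eraseSum F (l ::ₘ M) = F M + eraseSum (fun N => F (l ::ₘ N)) M := by
  simp only [eraseSum, Multiset.map_cons, Multiset.erase_cons_head, Multiset.sum_cons]
  congr 2
  refine Multiset.map_congr rfl fun x hx => ?_
  rw [Multiset.erase_cons_tail_of_mem hx]

lemma eraseSum_congr {α : Type*} [DecidableEq α] {F G : Multiset α → ZMod 2} {M : Multiset α}
    (h : ∀ N ≤ M, F N = G N) : eraseSum F M = eraseSum G M := by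
  unfold eraseSum
  congr 1
  exact Multiset.map_congr rfl fun x _ => h _ (Multiset.erase_le _ _)

lemma coboundary_multiset {α β : Type*} [DecidableEq α] (F : Multiset α → ZMod 2) (f : β → α)
    (l : List β) : coboundary (fun l => F ↑(l.map f)) l = eraseSum F ↑(l.map f) := by
  induction l generalizing F with
  | nil => simp [eraseSum]
  | cons x xs ih =>
    rw [coboundary_cons, List.map_cons, ← Multiset.cons_coe, eraseSum_cons, ← ih]
    rfl

/-- The antipode on signed labels. -/
def antipode (l : ι × Bool) : ι × Bool := (l.1, !l.2)

lemma alternating_cons {m : ι × Bool} {M : Multiset (ι × Bool)} (h : ∀ l ∈ M, l.1 < m.1) :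
    alternating (m ::ₘ M) = if m.2 = decide (Even M.card) then alternating M else 0 := by
  have h1 : m.1 ∉ M.map Prod.fst := by
    simp only [Multiset.mem_map, not_exists, not_and]
    exact fun l hl e => (h l hl).ne e
  have h2 : M.countP (·.1 < m.1) = M.card := Multiset.countP_eq_card.2 h
  have h3 : ∀ l ∈ M, (m ::ₘ M).countP (·.1 < l.1) = M.countP (·.1 < l.1) := fun l hl =>
    Multiset.countP_cons_of_neg _ (h l hl).not_gt
  have h4 : (∀ l ∈ m ::ₘ M, l.2 = decide (Even ((m ::ₘ M).countP (·.1 < l.1)))) ↔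
      m.2 = decide (Even M.card) ∧ ∀ l ∈ M, l.2 = decide (Even (M.countP (·.1 < l.1))) := by
    rw [Multiset.forall_mem_cons,
      Multiset.countP_cons_of_neg (p := fun l : ι × Bool => l.1 < m.1) _ (lt_irrefl m.1), h2]
    refine and_congr_right fun _ => forall₂_congr fun l hl => ?_
    rw [h3 l hl]
  unfold alternating
  simp only [h4, Multiset.map_cons, Multiset.nodup_cons, h1, not_false_eq_true, true_and]
  split_ifs <;> tauto

lemma alternating_of_not_nodup {M : Multiset (ι × Bool)} (h : ¬ (M.map Prod.fst).Nodup) :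
    alternating M = 0 := if_neg fun h' => h h'.1

lemma alternating_zero : alternating (0 : Multiset (ι × Bool)) = 1 := by simp [alternating]

lemma eraseSum_alternating (M : Multiset (ι × Bool))
    (hM : ∀ l ∈ M, ∀ l' ∈ M, l ≠ antipode l') :
    eraseSum alternating M = alternating M + alternating (M.map antipode) := by
  induction hn : M.card using Nat.strong_induction_on generalizing M with
  | _ n ih =>
  obtain rfl | hne := eq_or_ne M 0
  · simp [eraseSum, alternating_zero, CharTwo.add_self_eq_zero]
  obtain ⟨m, hm, hmax⟩ : ∃ m ∈ M, ∀ l ∈ M, l.1 ≤ m.1 := by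
    obtain ⟨l, hl⟩ := Multiset.exists_mem_of_ne_zero hne
    have := (M.toFinset).exists_max_image Prod.fst ⟨l, by simpa using hl⟩
    simpa using this
  obtain ⟨M, rfl⟩ := Multiset.exists_cons_of_mem hm
  by_cases hdup : ∃ l ∈ M, l.1 = m.1
  · obtain ⟨l, hl, he⟩ := hdup
    have : l = m := by
      have h1 := hM l (Multiset.mem_cons_of_mem hl) m (Multiset.mem_cons_self _ _)
      refine Prod.ext he ?_
      by_contra h2
      refine h1 (Prod.ext he ?_)
      simpa [antipode] using Bool.eq_not.2 h2
    subst this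
    obtain ⟨M, rfl⟩ := Multiset.exists_cons_of_mem hl
    rw [eraseSum_cons, eraseSum_cons, ← add_assoc, CharTwo.add_self_eq_zero,
      alternating_of_not_nodup (by simp), alternating_of_not_nodup (by simp [antipode]),
      eraseSum_congr (G := fun _ => 0) fun N _ => alternating_of_not_nodup (by simp)]
    simp [eraseSum]
  · push Not at hdup
    have hlt : ∀ l ∈ M, l.1 < m.1 := fun l hl =>
      (hmax l (Multiset.mem_cons_of_mem hl)).lt_of_ne (hdup l hl)
    have hlt' : ∀ l ∈ M.map antipode, l.1 < (antipode m).1 := fun l hl => by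
      obtain ⟨l, hl', rfl⟩ := Multiset.mem_map.1 hl
      exact hlt l hl'
    have ih' := ih M.card (by rw [← hn]; simp) M
      (fun l hl l' hl' => hM l (Multiset.mem_cons_of_mem hl) l' (Multiset.mem_cons_of_mem hl')) rfl
    rw [eraseSum_cons, Multiset.map_cons, alternating_cons hlt, alternating_cons hlt',
      Multiset.card_map]
    have key : eraseSum (fun N => alternating (m ::ₘ N)) M =
        if m.2 = decide (Even M.card) then 0 else eraseSum alternating M := by
      unfold eraseSum
      split_ifs with hs
      · rw [← Multiset.sum_map_zero (m := M)]
        congr 1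
        refine Multiset.map_congr rfl fun l hl => ?_
        beta_reduce
        rw [alternating_cons fun l' hl' => hlt l' (Multiset.mem_of_mem_erase hl')]
        obtain ⟨c, hc⟩ := Nat.exists_eq_succ_of_ne_zero (Multiset.card_pos_iff_exists_mem.2 ⟨l, hl⟩).ne'
        rw [if_neg]
        rw [hs, Multiset.card_erase_of_mem hl, hc]
        simp only [Nat.succ_eq_add_one, Nat.pred_succ, decide_eq_decide, Nat.even_add_one]
        tauto
      · congr 1
        refine Multiset.map_congr rfl fun l hl => ?_
        beta_reduce
        rw [alternating_cons fun l' hl' => hlt l' (Multiset.mem_of_mem_erase hl')]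
        obtain ⟨c, hc⟩ := Nat.exists_eq_succ_of_ne_zero (Multiset.card_pos_iff_exists_mem.2 ⟨l, hl⟩).ne'
        rw [if_pos]
        rw [hc] at hs
        rw [Multiset.card_erase_of_mem hl, hc]
        simp only [Nat.succ_eq_add_one, Nat.pred_succ, Nat.even_add_one] at hs ⊢
        by_cases he : Even c <;> simp_all
    rw [key, ih']
    by_cases hs : m.2 = decide (Even M.card)
    · have : ¬ (antipode m).2 = decide (Even M.card) := by simp [antipode, ← hs]
      rw [if_pos hs, if_pos hs, if_neg this]
    · have : (antipode m).2 = decide (Even M.card) := by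
        simp only [antipode]
        cases h : m.2 <;> simp_all
      rw [if_neg hs, if_neg hs, if_pos this, ← add_assoc, CharTwo.add_self_eq_zero]

lemma alternating_eq_zero_of_card [Fintype ι] {M : Multiset (ι × Bool)}
    (h : Fintype.card ι < M.card) : alternating M = 0 := by
  refine alternating_of_not_nodup fun hn => ?_
  have := Multiset.toFinset_card_of_nodup hn
  have h2 := (M.map Prod.fst).toFinset.card_le_univ
  rw [Multiset.card_map] at this
  omega

end Labels

section Linking

variable {X ι : Type*} [LinearOrder ι]

/-- The linking cochain of two point sequences with respect to a labelling of pairs of points. -/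
def linking (lab : X × X → ι × Bool) (a b : List X) : ZMod 2 :=
  shuffleSum (fun l => alternating (↑(l.map lab) : Multiset (ι × Bool))) a b

/-- Two point sequences are separated if no two pairs of their points have antipodal labels. -/
def Separated (lab : X × X → ι × Bool) (a b : List X) : Prop :=
  (∀ x ∈ a, ∀ y ∈ b, lab (y, x) = antipode (lab (x, y))) ∧
    ∀ x ∈ a, ∀ x' ∈ a, ∀ y ∈ b, ∀ y' ∈ b, lab (x, y) ≠ antipode (lab (x', y'))

lemma linking_add_swap (lab : X × X → ι × Bool) (a b : List X) (h : Separated lab a b) :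
    linking lab a b + linking lab b a =
      coboundary (fun a' => linking lab a' b) a + coboundary (fun b' => linking lab a b') b +
        if a.length = 1 ∧ b.length = 1 then 1 else 0 := by
  have h0 := shuffleSum_coboundary
    (fun l => alternating (↑(l.map lab) : Multiset (ι × Bool))) a b
  rw [show alternating (↑(([] : List (X × X)).map lab) : Multiset (ι × Bool)) = 1 from
    alternating_zero] at h0
  refine Eq.trans ?_ h0
  have h1 : linking lab b a = shuffleSum
      (fun l => alternating ((↑(l.map lab) : Multiset (ι × Bool)).map antipode)) a b := by
    rw [linking, ← shuffleSum_swap]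
    refine shuffleSum_congr _ _ _ _ fun l hl _ => ?_
    rw [Multiset.map_coe, List.map_map, List.map_map]
    congr 2
    refine List.map_congr_left fun p hp => ?_
    exact h.1 _ (hl p hp).1 _ (hl p hp).2
  rw [h1, linking, ← shuffleSum_add]
  refine shuffleSum_congr _ _ _ _ fun l hl _ => ?_
  rw [coboundary_multiset, eraseSum_alternating]
  intro m hm m' hm'
  simp only [Multiset.mem_coe, List.mem_map] at hm hm'
  obtain ⟨p, hp, rfl⟩ := hm
  obtain ⟨q, hq, rfl⟩ := hm'
  exact h.2 _ (hl p hp).1 _ (hl q hq).1 _ (hl p hp).2 _ (hl q hq).2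

lemma linking_eq_zero [Fintype ι] (lab : X × X → ι × Bool) (a b : List X)
    (h : Fintype.card ι + 1 < a.length + b.length) : linking lab a b = 0 := by
  rw [linking, shuffleSum_congr _ (fun _ => 0)]
  · have := shuffleSum_add (fun _ : List (X × X) => (0 : ZMod 2)) (fun _ => 0) a b
    simpa using this
  · intro l _ hl
    exact alternating_eq_zero_of_card (by simp; omega)

end Linking

/-- The augmented mod 2 chains spanned by finite sequences of points. -/
abbrev SeqChain (α : Type*) := List α →₀ ZMod 2

namespace SeqChain

section Basic

variable {α β : Type*}

/-- The chains supported on the sequences satisfying a given predicate. -/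
abbrev supportedOn (P : List α → Prop) : Submodule (ZMod 2) (SeqChain α) :=
  Finsupp.supported (ZMod 2) (ZMod 2) {l | P l}

lemma supportedOn_mono {P Q : List α → Prop} (h : ∀ l, P l → Q l) {c : SeqChain α}
    (hc : c ∈ supportedOn P) : c ∈ supportedOn Q :=
  Finsupp.supported_mono (fun l hl => h l hl) hc

lemma linearCombination_mem {γ M : Type*} [AddCommGroup M] [Module (ZMod 2) M] {s : Set γ}
    {v : γ → M} {S : Submodule (ZMod 2) M} (h : ∀ l ∈ s, v l ∈ S) {c : γ →₀ ZMod 2}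
    (hc : c ∈ Finsupp.supported (ZMod 2) (ZMod 2) s) :
    Finsupp.linearCombination (ZMod 2) v c ∈ S :=
  S.sum_mem fun l hl => S.smul_mem _ (h l (hc hl))

/-- The boundary of a single sequence. -/
noncomputable def seqBoundary : List α → SeqChain α
  | [] => 0
  | x :: xs => Finsupp.single xs 1 + Finsupp.mapDomain (List.cons x) (seqBoundary xs)

/-- The boundary operator. -/
noncomputable def boundary : SeqChain α →ₗ[ZMod 2] SeqChain α :=
  Finsupp.linearCombination (ZMod 2) seqBoundary

/-- The cone operator. -/
noncomputable def cone (x : α) : SeqChain α →ₗ[ZMod 2] SeqChain α :=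
  Finsupp.lmapDomain (ZMod 2) (ZMod 2) (List.cons x)

/-- The chain map induced by a map of points. -/
noncomputable def map (f : α → β) : SeqChain α →ₗ[ZMod 2] SeqChain β :=
  Finsupp.lmapDomain (ZMod 2) (ZMod 2) (List.map f)

@[simp] lemma cone_single (x : α) (l : List α) (a : ZMod 2) :
    cone x (Finsupp.single l a) = Finsupp.single (x :: l) a := by simp [cone]

@[simp] lemma map_single (f : α → β) (l : List α) (a : ZMod 2) :
    map f (Finsupp.single l a) = Finsupp.single (l.map f) a := by simp [map]

@[simp] lemma boundary_single (l : List α) :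
    boundary (Finsupp.single l 1) = seqBoundary l := by simp [boundary]

lemma seqBoundary_cons (x : α) (l : List α) :
    seqBoundary (x :: l) = Finsupp.single l 1 + cone x (seqBoundary l) := rfl

lemma boundary_cone (x : α) (c : SeqChain α) :
    boundary (cone x c) = c + cone x (boundary c) := by
  suffices boundary ∘ₗ cone x = LinearMap.id + cone x ∘ₗ boundary from LinearMap.congr_fun this c
  ext1 l
  ext1
  simp [seqBoundary_cons]

lemma add_self (c : SeqChain α) : c + c = 0 := by
  ext l
  exact CharTwo.add_self_eq_zero _

lemma boundary_boundary (c : SeqChain α) : boundary (boundary c) = 0 := by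
  suffices (boundary ∘ₗ boundary : SeqChain α →ₗ[ZMod 2] SeqChain α) = 0 from
    LinearMap.congr_fun this c
  ext1 l
  ext1
  simp only [LinearMap.coe_comp, Function.comp_apply, Finsupp.lsingle_apply, boundary_single,
    LinearMap.zero_apply]
  induction l with
  | nil => simp [seqBoundary]
  | cons x xs ih =>
    rw [seqBoundary_cons, map_add, boundary_single, boundary_cone, ih, map_zero, add_zero, add_self]

lemma boundary_map (f : α → β) (c : SeqChain α) : boundary (map f c) = map f (boundary c) := by
  suffices boundary ∘ₗ map f = map f ∘ₗ boundary from LinearMap.congr_fun this c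
  ext1 l
  ext1
  simp only [LinearMap.coe_comp, Function.comp_apply, Finsupp.lsingle_apply, boundary_single,
    map_single]
  induction l with
  | nil => simp [seqBoundary]
  | cons x xs ih =>
    rw [List.map_cons, seqBoundary_cons, seqBoundary_cons, map_add, ih, map_single]
    congr 1
    simp only [cone, map, Finsupp.lmapDomain_apply, ← Finsupp.mapDomain_comp]
    rfl

lemma map_comp {γ : Type*} (g : β → γ) (f : α → β) (c : SeqChain α) :
    map g (map f c) = map (g ∘ f) c := by
  simp only [map, Finsupp.lmapDomain_apply, ← Finsupp.mapDomain_comp]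
  congr 1
  ext1 l
  simp

lemma map_congr {f g : α → β} {c : SeqChain α}
    (h : c ∈ supportedOn fun l => ∀ x ∈ l, f x = g x) : map f c = map g c := by
  simp only [map, Finsupp.lmapDomain_apply]
  exact Finsupp.mapDomain_congr fun l hl => List.map_congr_left (h hl)

lemma map_mem {f : α → β} {P : List α → Prop} {Q : List β → Prop} (h : ∀ l, P l → Q (l.map f))
    {c : SeqChain α} (hc : c ∈ supportedOn P) : map f c ∈ supportedOn Q := by
  intro l hl
  classical
  obtain ⟨l', hl', rfl⟩ := Finset.mem_image.1 (Finsupp.mapDomain_support hl)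
  exact h _ (hc hl')

lemma cone_mem {x : α} {P Q : List α → Prop} (h : ∀ l, P l → Q (x :: l))
    {c : SeqChain α} (hc : c ∈ supportedOn P) : cone x c ∈ supportedOn Q := by
  intro l hl
  classical
  obtain ⟨l', hl', rfl⟩ := Finset.mem_image.1 (Finsupp.mapDomain_support hl)
  exact h _ (hc hl')

lemma seqBoundary_mem (l : List α) :
    seqBoundary l ∈ supportedOn fun l' => l' ⊆ l ∧ l'.length + 1 = l.length := by
  induction l with
  | nil => simp [seqBoundary]
  | cons x xs ih =>
    rw [seqBoundary_cons]
    refine Submodule.add_mem _ ?_ (cone_mem ?_ ih)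
    · exact Finsupp.single_mem_supported _ _ (by simp)
    · rintro l ⟨h1, h2⟩
      exact ⟨List.cons_subset_cons _ h1, by simp [h2]⟩

lemma linearCombination_boundary (φ : List α → ZMod 2) (c : SeqChain α) :
    Finsupp.linearCombination (ZMod 2) φ (boundary c) =
      Finsupp.linearCombination (ZMod 2) (coboundary φ) c := by
  suffices Finsupp.linearCombination (ZMod 2) φ ∘ₗ boundary =
      Finsupp.linearCombination (ZMod 2) (coboundary φ) from LinearMap.congr_fun this c
  ext1 l
  ext1
  simp only [LinearMap.coe_comp, Function.comp_apply, Finsupp.lsingle_apply, boundary_single,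
    Finsupp.linearCombination_single, one_smul]
  induction l generalizing φ with
  | nil => simp [seqBoundary]
  | cons x xs ih =>
    rw [seqBoundary_cons, map_add, Finsupp.linearCombination_single, one_smul, coboundary_cons,
      ← ih, cone, Finsupp.lmapDomain_apply, Finsupp.linearCombination_mapDomain]
    rfl

lemma seqBoundary_ofFn {n : ℕ} (g : Fin (n + 1) → α) :
    seqBoundary (List.ofFn g) =
      ∑ i : Fin (n + 1), Finsupp.single (List.ofFn fun j => g (i.succAbove j)) 1 := by
  induction n with
  | zero => simp [seqBoundary_cons, seqBoundary]
  | succ n ih =>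
    rw [List.ofFn_succ, seqBoundary_cons, ih, map_sum]
    conv_rhs => rw [Fin.sum_univ_succ]
    congr 1
    refine Finset.sum_congr rfl fun i _ => ?_
    rw [cone_single, List.ofFn_succ]
    simp

end Basic

section Subdivision

variable {V W : Type*} [NormedAddCommGroup V] [NormedSpace ℝ V]
  [NormedAddCommGroup W] [NormedSpace ℝ W]

/-- The barycenter of a sequence of points. -/
noncomputable def barycenter (l : List V) : V := (l.length : ℝ)⁻¹ • l.sum

lemma barycenter_mem {l : List V} (hl : l ≠ []) :
    barycenter l ∈ convexHull ℝ {x | x ∈ l} := by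
  have h0 : (l.length : ℝ) ≠ 0 := by simpa using hl
  have : barycenter l = ∑ i : Fin l.length, (l.length : ℝ)⁻¹ • l[i] := by
    rw [barycenter, ← Finset.smul_sum, ← Fin.sum_univ_getElem]
    rfl
  rw [this]
  refine (convex_convexHull ℝ _).sum_mem (fun _ _ => by positivity) ?_ fun i _ =>
    subset_convexHull ℝ _ (by simp)
  simp [h0]

lemma norm_sum_sub_le (l : List V) (v : V) :
    ‖l.sum - (l.length : ℝ) • v‖ ≤ (l.map (dist · v)).sum := by
  induction l with
  | nil => simp
  | cons x xs ih =>
    simp only [List.sum_cons, List.length_cons, List.map_cons, Nat.cast_add, Nat.cast_one]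
    calc _ = ‖(x - v) + (xs.sum - (xs.length : ℝ) • v)‖ := by congr 1; module
      _ ≤ _ := (norm_add_le _ _).trans (by rw [← dist_eq_norm]; gcongr)

lemma dist_barycenter_le {l : List V} {D : ℝ} (hD : ∀ x ∈ l, ∀ y ∈ l, dist x y ≤ D)
    {v : V} (hv : v ∈ convexHull ℝ {x | x ∈ l}) :
    dist v (barycenter l) ≤ (1 - (l.length : ℝ)⁻¹) * D := by
  have key : ∀ v ∈ l, dist v (barycenter l) ≤ (1 - (l.length : ℝ)⁻¹) * D := by
    classical
    intro v hv
    have h0 : (l.length : ℝ) ≠ 0 := by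
      simpa using List.ne_nil_of_mem hv
    have h1 : (l.map (dist · v)).sum ≤ (l.length - 1) * D := by
      have hp := List.perm_cons_erase hv
      rw [(hp.map _).sum_eq, List.map_cons, List.sum_cons, dist_self, zero_add]
      have := List.sum_le_card_nsmul ((l.erase v).map (dist · v)) D (by
        simp only [List.mem_map, forall_exists_index, and_imp, forall_apply_eq_imp_iff₂]
        exact fun x hx => hD x (List.mem_of_mem_erase hx) v hv)
      rw [List.length_map, List.length_erase_of_mem hv, nsmul_eq_mul,
        Nat.cast_sub (List.length_pos_of_mem hv)] at this
      simpa using this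
    have h2 : dist v (barycenter l) = (l.length : ℝ)⁻¹ * ‖l.sum - (l.length : ℝ) • v‖ := by
      rw [dist_comm, dist_eq_norm, barycenter, ← Real.norm_of_nonneg (inv_nonneg.2
        (Nat.cast_nonneg l.length)), ← norm_smul, Real.norm_of_nonneg (by positivity), smul_sub,
        smul_smul, inv_mul_cancel₀ h0, one_smul]
    rw [h2]
    calc _ ≤ (l.length : ℝ)⁻¹ * ((l.length - 1) * D) := by
          gcongr
          exact (norm_sum_sub_le l v).trans h1
      _ = _ := by field_simp
  have : convexHull ℝ {x | x ∈ l} ⊆ Metric.closedBall (barycenter l) ((1 - (l.length : ℝ)⁻¹) * D) :=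
    convexHull_min (fun v hv => key v hv) (convex_closedBall _ _)
  exact this hv

/-- The barycentric subdivision of chains spanned by sequences of length `n`. -/
noncomputable def subdivision : ℕ → SeqChain V →ₗ[ZMod 2] SeqChain V
  | 0 => LinearMap.id
  | n + 1 => Finsupp.linearCombination (ZMod 2) fun l =>
      cone (barycenter l) (subdivision n (seqBoundary l))

lemma subdivision_succ_single (n : ℕ) (l : List V) :
    subdivision (n + 1) (Finsupp.single l 1) =
      cone (barycenter l) (subdivision n (seqBoundary l)) := by
  simp [subdivision]

lemma boundary_subdivision (n : ℕ) (c : SeqChain V) :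
    boundary (subdivision (n + 1) c) = subdivision n (boundary c) := by
  suffices (boundary ∘ₗ subdivision (n + 1) : SeqChain V →ₗ[ZMod 2] SeqChain V) =
    subdivision n ∘ₗ boundary from LinearMap.congr_fun this c
  ext1 l
  ext1
  simp only [LinearMap.coe_comp, Function.comp_apply, Finsupp.lsingle_apply,
    subdivision_succ_single, boundary_cone, boundary_single]
  suffices boundary (subdivision n (seqBoundary l)) = 0 by rw [this, map_zero, add_zero]
  rw [← boundary_single]
  induction n generalizing l with
  | zero => exact boundary_boundary _
  | succ n ih =>
    generalize hc : boundary (Finsupp.single l 1) = c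
    have hc' : boundary c = 0 := by rw [← hc, boundary_boundary]
    have : ∀ c : SeqChain V, boundary (subdivision (n + 1) c) = subdivision n (boundary c) := by
      intro c
      induction c using Finsupp.induction_linear with
      | zero => simp
      | add a b ha hb => simp [ha, hb]
      | single l a =>
        rw [show Finsupp.single l a = a • Finsupp.single l (1 : ZMod 2) by simp, map_smul,
          map_smul, map_smul, map_smul, subdivision_succ_single, boundary_cone,
          ← boundary_single, ih, map_zero, add_zero]
    rw [this, hc', map_zero]

lemma boundary_subdivision_pow (n N : ℕ) (c : SeqChain V) :
    boundary ((subdivision (n + 1) ^ N) c) = (subdivision n ^ N) (boundary c) := by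
  induction N generalizing c with
  | zero => simp
  | succ N ih => rw [pow_succ, pow_succ, Module.End.mul_apply, Module.End.mul_apply, ih,
      boundary_subdivision]

lemma barycenter_map (g : V →ₗ[ℝ] W) (l : List V) : barycenter (l.map g) = g (barycenter l) := by
  rw [barycenter, barycenter, map_smul, List.length_map, map_list_sum]

lemma subdivision_map (g : V →ₗ[ℝ] W) (n : ℕ) (c : SeqChain V) :
    subdivision n (map g c) = map g (subdivision n c) := by
  induction n generalizing c with
  | zero => rfl
  | succ n ih =>
    suffices subdivision (n + 1) ∘ₗ map g = map g ∘ₗ subdivision (n + 1) from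
      LinearMap.congr_fun this c
    ext1 l
    ext1
    simp only [LinearMap.coe_comp, Function.comp_apply, Finsupp.lsingle_apply, map_single,
      subdivision_succ_single, barycenter_map]
    rw [← boundary_single, ← map_single, boundary_map, ih, boundary_single]
    simp only [cone, map, Finsupp.lmapDomain_apply, ← Finsupp.mapDomain_comp]
    rfl

lemma subdivision_pow_map (g : V →ₗ[ℝ] W) (n N : ℕ) (c : SeqChain V) :
    (subdivision n ^ N) (map g c) = map g ((subdivision n ^ N) c) := by
  induction N generalizing c with
  | zero => simp
  | succ N ih => rw [pow_succ, pow_succ, Module.End.mul_apply, Module.End.mul_apply,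
      subdivision_map, ih]

lemma subdivision_mem {m : ℕ} (n : ℕ) (hnm : n ≤ m) (l : List V) (hl : l.length = n) {D : ℝ}
    (hD0 : 0 ≤ D) (hD : ∀ x ∈ l, ∀ y ∈ l, dist x y ≤ D) :
    subdivision n (Finsupp.single l 1) ∈ supportedOn fun l' => l'.length = n ∧
      (∀ x ∈ l', x ∈ convexHull ℝ {x | x ∈ l}) ∧
      ∀ x ∈ l', ∀ y ∈ l', dist x y ≤ (1 - (m : ℝ)⁻¹) * D := by
  induction n generalizing l with
  | zero =>
    obtain rfl := List.length_eq_zero_iff.1 hl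
    exact Finsupp.single_mem_supported _ _ (by simp)
  | succ n ih =>
    rw [subdivision_succ_single]
    have hne : l ≠ [] := by rintro rfl; simp at hl
    have hinv : (m : ℝ)⁻¹ ≤ (l.length : ℝ)⁻¹ :=
      inv_anti₀ (by rw [hl]; positivity) (by rw [hl]; exact_mod_cast hnm)
    have hm1 : (m : ℝ)⁻¹ ≤ 1 := inv_le_one_of_one_le₀ (by exact_mod_cast (by omega : 1 ≤ m))
    have key : subdivision n (seqBoundary l) ∈ supportedOn fun l' => l'.length = n ∧
        (∀ x ∈ l', x ∈ convexHull ℝ {x | x ∈ l}) ∧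
        ∀ x ∈ l', ∀ y ∈ l', dist x y ≤ (1 - (m : ℝ)⁻¹) * D := by
      have h1 := seqBoundary_mem l
      rw [← Finsupp.sum_single (seqBoundary l), Finsupp.sum, map_sum]
      refine Submodule.sum_mem _ fun l' hl' => ?_
      rw [show Finsupp.single l' (seqBoundary l l') =
        (seqBoundary l l') • Finsupp.single l' (1 : ZMod 2) by simp, map_smul]
      refine Submodule.smul_mem _ _ ?_
      obtain ⟨h2, h3⟩ := h1 hl'
      refine supportedOn_mono ?_ (ih (by omega) l' (by omega)
        fun x hx y hy => hD x (h2 hx) y (h2 hy))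
      rintro l'' ⟨h4, h5, h6⟩
      exact ⟨h4, fun x hx => convexHull_mono (fun y hy => h2 hy) (h5 x hx), h6⟩
    refine cone_mem ?_ key
    rintro l' ⟨h1, h2, h3⟩
    have hb : ∀ x ∈ l', dist x (barycenter l) ≤ (1 - (m : ℝ)⁻¹) * D := fun x hx =>
      (dist_barycenter_le hD (h2 x hx)).trans (by gcongr)
    refine ⟨by simp [h1], ?_, ?_⟩
    · simp only [List.mem_cons, forall_eq_or_imp]
      exact ⟨barycenter_mem hne, h2⟩
    · simp only [List.mem_cons, forall_eq_or_imp, dist_self]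
      exact ⟨⟨mul_nonneg (by linarith) hD0, fun x hx => by rw [dist_comm]; exact hb x hx⟩,
        fun x hx => ⟨hb x hx, h3 x hx⟩⟩

lemma subdivision_pow_mem (n N : ℕ) (l : List V) (hl : l.length = n + 1) {D : ℝ}
    (hD0 : 0 ≤ D) (hD : ∀ x ∈ l, ∀ y ∈ l, dist x y ≤ D) :
    (subdivision (n + 1) ^ N) (Finsupp.single l 1) ∈ supportedOn fun l' => l'.length = n + 1 ∧
      (∀ x ∈ l', x ∈ convexHull ℝ {x | x ∈ l}) ∧
      ∀ x ∈ l', ∀ y ∈ l', dist x y ≤ (1 - ((n + 1 : ℕ) : ℝ)⁻¹) ^ N * D := by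
  induction N with
  | zero =>
    refine Finsupp.single_mem_supported _ _ ?_
    exact ⟨hl, fun x hx => subset_convexHull ℝ _ hx, by simpa using hD⟩
  | succ N ih =>
    rw [show (subdivision (n + 1) ^ (N + 1) : SeqChain V →ₗ[ZMod 2] SeqChain V) =
      subdivision (n + 1) * subdivision (n + 1) ^ N from pow_succ' _ _, Module.End.mul_apply]
    generalize (subdivision (n + 1) ^ N) (Finsupp.single l 1) = c at ih
    rw [← Finsupp.sum_single c, Finsupp.sum, map_sum]
    refine Submodule.sum_mem _ fun l' hl' => ?_
    rw [show Finsupp.single l' (c l') = (c l') • Finsupp.single l' (1 : ZMod 2) by simp, map_smul]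
    refine Submodule.smul_mem _ _ ?_
    obtain ⟨h1, h2, h3⟩ := ih hl'
    have hm1 : ((n + 1 : ℕ) : ℝ)⁻¹ ≤ 1 := inv_le_one_of_one_le₀ (by simp)
    refine supportedOn_mono ?_ (subdivision_mem (n + 1) le_rfl l' h1
      (mul_nonneg (pow_nonneg (by linarith) _) hD0) h3)
    rintro l'' ⟨h4, h5, h6⟩
    refine ⟨h4, fun x hx => convexHull_min (fun y hy => h2 y hy) (convex_convexHull ℝ _) (h5 x hx),
      fun x hx y hy => (h6 x hx y hy).trans_eq ?_⟩
    rw [pow_succ]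
    ring

end Subdivision

end SeqChain

section Direction

variable {d : ℕ} [NeZero d]

/-- An index at which a tuple attains its largest value. -/
noncomputable def maxIndex (v : Fin d → ℝ) : Fin d := (Finite.exists_max v).choose

lemma le_maxIndex (v : Fin d → ℝ) (i : Fin d) : v i ≤ v (maxIndex v) :=
  (Finite.exists_max v).choose_spec i

/-- The facet of the cube hit by the direction from one point to another. -/
noncomputable def direction (p : (Fin d → ℝ) × (Fin d → ℝ)) : Fin d × Bool :=
  let i := maxIndex fun j => |p.1 j - p.2 j|
  (i, decide (p.2 i < p.1 i))

lemma dist_eq_maxIndex (x y : Fin d → ℝ) :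
    dist x y = |x (maxIndex fun j => |x j - y j|) - y (maxIndex fun j => |x j - y j|)| := by
  refine le_antisymm ((dist_pi_le_iff (abs_nonneg _)).2 fun j => ?_) ?_
  · rw [Real.dist_eq]
    exact le_maxIndex (fun j => |x j - y j|) j
  · rw [← Real.dist_eq]
    exact dist_le_pi_dist x y _

lemma direction_swap {x y : Fin d → ℝ} (h : x ≠ y) : direction (y, x) = antipode (direction (x, y)) := by
  have h1 : (fun j => |y j - x j|) = fun j => |x j - y j| := by
    ext j
    exact abs_sub_comm _ _
  have h2 := dist_eq_maxIndex x y
  simp only [direction, antipode, h1]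
  generalize (maxIndex fun j => |x j - y j|) = i at h2
  have h3 : x i ≠ y i := by
    intro h4
    rw [h4, sub_self, abs_zero] at h2
    exact h (dist_eq_zero.1 h2)
  rcases h3.lt_or_gt with h4 | h4
  · simp [h4, h4.le]
  · simp [h4, h4.le]

lemma direction_ne_antipode {ε : ℝ} {x y x' y' : Fin d → ℝ} (hx : dist x x' < ε)
    (hy : dist y y' < ε) (hxy : ε ≤ dist x y) (hxy' : ε ≤ dist x' y') :
    direction (x, y) ≠ antipode (direction (x', y')) := by
  intro h
  rw [dist_eq_maxIndex] at hxy hxy'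
  simp only [direction, antipode, Prod.mk.injEq] at h
  obtain ⟨h1, h2⟩ := h
  rw [← h1] at h2 hxy'
  generalize (maxIndex fun j => |x j - y j|) = i at h2 hxy hxy'
  have h3 : |x i - x' i| < ε := by
    rw [← Real.dist_eq]
    exact (dist_le_pi_dist x x' i).trans_lt hx
  have h4 : |y i - y' i| < ε := by
    rw [← Real.dist_eq]
    exact (dist_le_pi_dist y y' i).trans_lt hy
  have h5 : y i < x i ↔ ¬ y' i < x' i := by
    by_cases h6 : y i < x i <;> by_cases h7 : y' i < x' i <;> simp_all
  rw [abs_lt] at h3 h4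
  by_cases h6 : y i < x i
  · have := h5.1 h6
    rw [abs_of_pos (by linarith)] at hxy
    rw [abs_of_nonpos (by linarith)] at hxy'
    linarith
  · have : y' i < x' i := by tauto
    rw [abs_of_nonpos (by linarith)] at hxy
    rw [abs_of_pos (by linarith)] at hxy'
    linarith

lemma separated_direction {ε : ℝ} (hε : 0 < ε) {a b : List (Fin d → ℝ)}
    (ha : ∀ x ∈ a, ∀ x' ∈ a, dist x x' < ε) (hb : ∀ y ∈ b, ∀ y' ∈ b, dist y y' < ε)
    (hab : ∀ x ∈ a, ∀ y ∈ b, ε ≤ dist x y) : Separated direction a b := by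
  refine ⟨fun x hx y hy => direction_swap ?_, fun x hx x' hx' y hy y' hy' =>
    direction_ne_antipode (ha x hx x' hx') (hb y hy y' hy') (hab x hx y hy) (hab x' hx' y' hy')⟩
  rintro rfl
  have := hab x hx x hy
  rw [dist_self] at this
  linarith

end Direction

/-- Mod 2 singular chains. -/
abbrev SingularChain (X : Type*) [TopologicalSpace X] (n : ℕ) :=
  C(stdSimplex ℝ (Fin (n + 1)), X) →₀ ZMod 2

namespace SingularChain

variable {X Y : Type*} [TopologicalSpace X] [TopologicalSpace Y]

/-- The faces of a singular simplex. -/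
noncomputable def face {n : ℕ} (i : Fin (n + 2)) (f : C(stdSimplex ℝ (Fin (n + 2)), X)) :
    C(stdSimplex ℝ (Fin (n + 1)), X) :=
  f.comp ⟨stdSimplex.map i.succAbove, stdSimplex.continuous_map _⟩

/-- The boundary operator on singular chains. -/
noncomputable def boundary (n : ℕ) : SingularChain X (n + 1) →ₗ[ZMod 2] SingularChain X n :=
  Finsupp.linearCombination (ZMod 2) fun f => ∑ i, Finsupp.single (face i f) 1

@[simp] lemma boundary_single (n : ℕ) (f : C(stdSimplex ℝ (Fin (n + 2)), X)) :
    boundary n (Finsupp.single f 1) = ∑ i, Finsupp.single (face i f) 1 := by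
  simp [boundary]

/-- The chain map induced by a continuous map. -/
noncomputable def push (g : C(X, Y)) (n : ℕ) : SingularChain X n →ₗ[ZMod 2] SingularChain Y n :=
  Finsupp.lmapDomain _ _ g.comp

lemma boundary_push (g : C(X, Y)) (n : ℕ) (c : SingularChain X (n + 1)) :
    boundary n (push g (n + 1) c) = push g n (boundary n c) := by
  suffices boundary n ∘ₗ push g (n + 1) = push g n ∘ₗ boundary n from LinearMap.congr_fun this c
  ext1 f
  ext1
  simp [push, face, ContinuousMap.comp_assoc]

open Simplicial in
lemma exists_boundary_eq {X : Type} [TopologicalSpace X] {n : ℕ}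
    (h : Subsingleton (SingularHomology (ZMod 2) X (n + 1)))
    (z : SingularChain X (n + 1)) (hz : boundary n z = 0) :
    ∃ y : SingularChain X (n + 2), boundary (n + 1) y = z := by
  let S := TopCat.toSSet.obj (TopCat.of X)
  let e : ∀ m : ℕ, C(stdSimplex ℝ (Fin (m + 1)), X) ≃ S _⦋m⦌ := fun m =>
    ((TopCat.of X).toSSetObjEquiv (Opposite.op ⦋m⦌)).symm
  let K := (alternatingFaceMapComplex (ModuleCat (ZMod 2))).obj
      (((SimplicialObject.whiskering _ _).obj (ModuleCat.free (ZMod 2))).obj S)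
  let E : ∀ m : ℕ, SingularChain X m →ₗ[ZMod 2] K.X m := fun m =>
    Finsupp.lmapDomain (ZMod 2) (ZMod 2) (e m)
  have hE : ∀ m, Function.Bijective (E m) := fun m =>
    ⟨Finsupp.mapDomain_injective (e m).injective, Finsupp.mapDomain_surjective (e m).surjective⟩
  have hd : ∀ m (c : SingularChain X (m + 1)), K.d (m + 1) m (E (m + 1) c) = E m (boundary m c) := by
    intro m c
    suffices (K.d (m + 1) m).hom ∘ₗ E (m + 1) = E m ∘ₗ boundary m from LinearMap.congr_fun this c
    refine Finsupp.lhom_ext' fun f => LinearMap.ext_ring ?_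
    simp only [LinearMap.coe_comp, Function.comp_apply, Finsupp.lsingle_apply, boundary_single,
      map_sum]
    have h1 : K.d (m + 1) m = ∑ i : Fin (m + 2), ((-1 : ℤ) ^ (i : ℕ)) •
        (ModuleCat.free (ZMod 2)).map (S.δ i) := alternatingFaceMapComplex_obj_d _ _
    have h2 : ∀ (i : Fin (m + 2)) (x : S _⦋m + 1⦌), (((-1 : ℤ) ^ (i : ℕ)) •
        (ModuleCat.free (ZMod 2)).map (S.δ i)).hom (ModuleCat.freeMk x) =
          ModuleCat.freeMk (S.δ i x) := by
      intro i x
      have h3 : ∀ w : (ModuleCat.free (ZMod 2)).obj (S _⦋m⦌), -w = w := fun w => by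
        rw [neg_eq_iff_add_eq_zero, ← two_smul (ZMod 2) w]
        exact (congrArg (· • w) (CharTwo.two_eq_zero (R := ZMod 2))).trans (zero_smul _ w)
      rcases neg_one_pow_eq_or ℤ (i : ℕ) with h4 | h4
      · rw [h4, one_smul]
        exact ModuleCat.free_map_apply _ _
      · rw [h4, neg_smul, one_smul, ModuleCat.hom_neg, LinearMap.neg_apply, h3]
        exact ModuleCat.free_map_apply _ _
    have h3 : ∀ x : S _⦋m + 1⦌, (∑ i : Fin (m + 2), ((-1 : ℤ) ^ (i : ℕ)) •
        (ModuleCat.free (ZMod 2)).map (S.δ i)).hom (ModuleCat.freeMk x) =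
          ∑ i : Fin (m + 2), ModuleCat.freeMk (S.δ i x) := by
      intro x
      rw [ModuleCat.hom_sum, LinearMap.sum_apply]
      exact Finset.sum_congr rfl fun i _ => h2 i x
    have h4 : E (m + 1) (Finsupp.single f 1) = ModuleCat.freeMk (e (m + 1) f) :=
      Finsupp.mapDomain_single
    rw [h4]
    refine (congrArg (fun φ => φ.hom (ModuleCat.freeMk (e (m + 1) f))) h1).trans ((h3 _).trans ?_)
    refine Finset.sum_congr rfl fun i _ => ?_
    exact (Finsupp.mapDomain_single (f := e m) (a := face i f) (M := ZMod 2) (b := 1)).symm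
  have hex : K.ExactAt (n + 1) := by
    rw [HomologicalComplex.exactAt_iff_isZero_homology]
    have : Subsingleton (K.homology (n + 1)) := h
    exact ModuleCat.isZero_of_subsingleton _
  rw [HomologicalComplex.exactAt_iff' K (n + 2) (n + 1) n (by simp) (by simp),
    ShortComplex.moduleCat_exact_iff] at hex
  obtain ⟨y, hy⟩ := hex (E _ z) (by
    change K.d (n + 1) n (E (n + 1) z) = 0
    rw [hd, hz, map_zero])
  obtain ⟨y, rfl⟩ := (hE _).2 y
  refine ⟨y, (hE _).1 ?_⟩
  rw [← hd]
  exact hy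

end SingularChain

namespace SingularChain

/-- The singular chains contained in a subset. -/
abbrev within {X : Type*} [TopologicalSpace X] (A : Set X) (n : ℕ) :
    Submodule (ZMod 2) (SingularChain X n) :=
  Finsupp.supported (ZMod 2) (ZMod 2) {f | ∀ x, f x ∈ A}

/-- The singular simplex of dimension zero at a point. -/
noncomputable def point {X : Type*} [TopologicalSpace X] (a : X) : SingularChain X 0 :=
  Finsupp.single (ContinuousMap.const _ a) 1

lemma point_mem {X : Type*} [TopologicalSpace X] {A : Set X} {a : X} (ha : a ∈ A) :
    point a ∈ within A 0 :=
  Finsupp.single_mem_supported _ _ fun _ => ha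

lemma range_push_val {X : Type*} [TopologicalSpace X] (A : Set X) (n : ℕ) :
    LinearMap.range (push (⟨Subtype.val, continuous_subtype_val⟩ : C(A, X)) n) = within A n := by
  have h := Finsupp.lmapDomain_supported (M := ZMod 2) (R := ZMod 2)
    (⟨Subtype.val, continuous_subtype_val⟩ : C(A, X)).comp
    (Set.univ : Set C(stdSimplex ℝ (Fin (n + 1)), A))
  rw [Finsupp.supported_univ, Submodule.map_top] at h
  rw [push, h]
  congr 1
  ext f
  simp only [Set.image_univ, Set.mem_range, Set.mem_ofPred_eq]
  constructor
  · rintro ⟨g, rfl⟩ x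
    exact (g x).2
  · intro hf
    exact ⟨⟨fun x => ⟨f x, hf x⟩, by fun_prop⟩, rfl⟩

lemma exists_within_boundary_eq {X : Type} [TopologicalSpace X] {A : Set X} {n : ℕ}
    (h : Subsingleton (SingularHomology (ZMod 2) A (n + 1))) {z : SingularChain X (n + 1)}
    (hz : z ∈ within A (n + 1)) (hz0 : boundary n z = 0) :
    ∃ y ∈ within A (n + 2), boundary (n + 1) y = z := by
  rw [← range_push_val] at hz
  obtain ⟨z, rfl⟩ := hz
  have hinj : Function.Injective (push (⟨Subtype.val, continuous_subtype_val⟩ : C(A, X)) n) := by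
    refine Finsupp.mapDomain_injective fun f g hfg => ?_
    ext x
    exact congrArg (fun h : C(_, X) => h x) hfg
  rw [boundary_push] at hz0
  obtain ⟨y, rfl⟩ := exists_boundary_eq h z (hinj (hz0.trans (map_zero _).symm))
  refine ⟨push ⟨Subtype.val, continuous_subtype_val⟩ _ y, ?_, boundary_push _ _ _⟩
  rw [← range_push_val]
  exact ⟨y, rfl⟩

lemma exists_within_boundary_eq_point {X : Type*} [TopologicalSpace X] {A : Set X}
    (h : IsPathConnected A) {a b : X} (ha : a ∈ A) (hb : b ∈ A) :
    ∃ y ∈ within A 1, boundary 0 y = point a + point b := by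
  obtain ⟨γ, hγ⟩ := h.joinedIn a ha b hb
  let f : C(stdSimplex ℝ (Fin 2), X) :=
    γ.toContinuousMap.comp ⟨stdSimplexHomeomorphUnitInterval, by fun_prop⟩
  have hf : ∀ i x, face (n := 0) i f x = f (stdSimplex.vertex (i.succAbove 0)) := by
    intro i x
    rw [Subsingleton.elim x (stdSimplex.vertex 0)]
    exact congrArg f (stdSimplex.map_vertex _ _)
  refine ⟨Finsupp.single f 1, Finsupp.single_mem_supported _ _ fun x => hγ _, ?_⟩
  rw [boundary_single, Fin.sum_univ_two, add_comm]
  congr 2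
  · ext x
    rw [hf]
    exact (congrArg γ stdSimplexHomeomorphUnitInterval_zero).trans γ.source
  · ext x
    rw [hf]
    exact (congrArg γ stdSimplexHomeomorphUnitInterval_one).trans γ.target

end SingularChain

namespace SingularChain

/-- The sequence of vertices of the standard simplex. -/
noncomputable def vertices (n : ℕ) : List (Fin (n + 1) → ℝ) := List.ofFn fun i => Pi.single i 1

lemma subdivision_vertices_mem (n N : ℕ) :
    (SeqChain.subdivision (n + 1) ^ N) (Finsupp.single (vertices n) 1) ∈
      SeqChain.supportedOn fun l => l.length = n + 1 ∧ (∀ x ∈ l, x ∈ stdSimplex ℝ (Fin (n + 1))) ∧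
        ∀ x ∈ l, ∀ y ∈ l, dist x y ≤ (1 - ((n + 1 : ℕ) : ℝ)⁻¹) ^ N := by
  have hv : ∀ x ∈ vertices n, x ∈ stdSimplex ℝ (Fin (n + 1)) := by
    intro x hx
    obtain ⟨i, rfl⟩ := List.mem_ofFn.1 hx
    exact single_mem_stdSimplex ℝ i
  refine SeqChain.supportedOn_mono ?_ (SeqChain.subdivision_pow_mem n N (vertices n)
    (by simp [vertices]) zero_le_one fun x hx y hy => ?_)
  · rintro l ⟨h1, h2, h3⟩
    exact ⟨h1, fun x hx => convexHull_min (fun y hy => hv y hy) (convex_stdSimplex ℝ _) (h2 x hx),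
      fun x hx y hy => by simpa using h3 x hx y hy⟩
  · exact (Metric.dist_le_diam_of_mem (bounded_stdSimplex _) (hv x hx) (hv y hy)).trans
      diam_stdSimplex_le

variable {X : Type*}

open Classical in
/-- An arbitrary extension of a singular simplex to the ambient vector space. -/
noncomputable def extend [TopologicalSpace X] {n : ℕ} (f : C(stdSimplex ℝ (Fin (n + 1)), X))
    (x : Fin (n + 1) → ℝ) : X :=
  if h : x ∈ stdSimplex ℝ (Fin (n + 1)) then f ⟨x, h⟩ else f (stdSimplex.vertex 0)

/-- The chain of point sequences obtained from a singular chain by iterated subdivision. -/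
noncomputable def discretize [TopologicalSpace X] (N n : ℕ) :
    SingularChain X n →ₗ[ZMod 2] SeqChain X :=
  Finsupp.linearCombination (ZMod 2) fun f => SeqChain.map (extend f)
    ((SeqChain.subdivision (n + 1) ^ N) (Finsupp.single (vertices n) 1))

@[simp] lemma discretize_single [TopologicalSpace X] (N n : ℕ)
    (f : C(stdSimplex ℝ (Fin (n + 1)), X)) :
    discretize N n (Finsupp.single f 1) = SeqChain.map (extend f)
      ((SeqChain.subdivision (n + 1) ^ N) (Finsupp.single (vertices n) 1)) := by
  simp [discretize]

lemma discretize_point [TopologicalSpace X] (N : ℕ) (a : X) :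
    discretize N 0 (point a) = Finsupp.single [a] 1 := by
  have h : ∀ N, (SeqChain.subdivision 1 ^ N) (Finsupp.single (vertices 0) 1) =
      Finsupp.single (vertices 0) (1 : ZMod 2) := by
    intro N
    induction N with
    | zero => simp
    | succ N ih =>
      rw [pow_succ, Module.End.mul_apply, SeqChain.subdivision_succ_single]
      convert ih
      simp [vertices, SeqChain.seqBoundary, SeqChain.subdivision, SeqChain.barycenter]
  rw [point, discretize_single, h]
  simp [vertices, extend, single_mem_stdSimplex]

lemma boundary_discretize [TopologicalSpace X] (N n : ℕ) (c : SingularChain X (n + 1)) :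
    SeqChain.boundary (discretize N (n + 1) c) = discretize N n (boundary n c) := by
  suffices SeqChain.boundary ∘ₗ discretize N (n + 1) = discretize N n ∘ₗ boundary n from
    LinearMap.congr_fun this c
  refine Finsupp.lhom_ext' fun f => LinearMap.ext_ring ?_
  simp only [LinearMap.coe_comp, Function.comp_apply, Finsupp.lsingle_apply, boundary_single,
    map_sum, discretize_single]
  rw [SeqChain.boundary_map, SeqChain.boundary_subdivision_pow, SeqChain.boundary_single, vertices,
    SeqChain.seqBoundary_ofFn, map_sum, map_sum]
  refine Finset.sum_congr rfl fun i _ => ?_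
  have h1 : (Finsupp.single (List.ofFn fun j : Fin (n + 1) =>
      (Pi.single (i.succAbove j) 1 : Fin (n + 2) → ℝ)) 1 : SeqChain (Fin (n + 2) → ℝ)) =
      SeqChain.map (FunOnFinite.linearMap ℝ ℝ i.succAbove) (Finsupp.single (vertices n) 1) := by
    rw [SeqChain.map_single, vertices, List.map_ofFn]
    congr 2
    ext1 j
    simp
  rw [h1, SeqChain.subdivision_pow_map, SeqChain.map_comp]
  refine SeqChain.map_congr (SeqChain.supportedOn_mono ?_ (subdivision_vertices_mem n N))
  rintro l ⟨-, h2, -⟩ x hx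
  have h3 : FunOnFinite.linearMap ℝ ℝ i.succAbove x ∈ stdSimplex ℝ (Fin (n + 2)) :=
    stdSimplex.image_linearMap _ ⟨x, h2 x hx, rfl⟩
  rw [Function.comp_apply, extend, extend, dif_pos h3, dif_pos (h2 x hx)]
  rfl

/-- The union of the simplices occurring in a chain. -/
def carrier [TopologicalSpace X] {n : ℕ} (c : SingularChain X n) : Set X :=
  ⋃ f ∈ c.support, Set.range f

lemma isCompact_carrier [TopologicalSpace X] {n : ℕ} (c : SingularChain X n) :
    IsCompact (carrier c) :=
  c.support.isCompact_biUnion fun f _ => isCompact_range f.continuous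

lemma carrier_subset [TopologicalSpace X] {n : ℕ} {c : SingularChain X n} {A : Set X}
    (h : c ∈ within A n) : carrier c ⊆ A := by
  refine Set.iUnion₂_subset fun f hf => ?_
  rintro _ ⟨x, rfl⟩
  exact h hf x

lemma discretize_mem [TopologicalSpace X] {n : ℕ} {c : SingularChain X n} {P : List X → Prop}
    {N : ℕ} (h : ∀ f ∈ c.support, discretize N n (Finsupp.single f 1) ∈ SeqChain.supportedOn P) :
    discretize N n c ∈ SeqChain.supportedOn P := by
  refine SeqChain.linearCombination_mem (s := c.support) (fun f hf => ?_) fun f hf => hf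
  rw [← discretize_single]
  exact h f hf

lemma length_of_mem_discretize [TopologicalSpace X] {n N : ℕ} {c : SingularChain X n} {l : List X}
    (hl : l ∈ (discretize N n c).support) : l.length = n + 1 := by
  have : discretize N n c ∈ SeqChain.supportedOn fun l => l.length = n + 1 := by
    refine discretize_mem fun f _ => ?_
    rw [discretize_single]
    exact SeqChain.map_mem (fun l h => by simpa using h.1) (subdivision_vertices_mem n N)
  exact this hl

lemma eventually_discretize_mem [PseudoMetricSpace X] {n : ℕ} (c : SingularChain X n) {ε : ℝ}
    (hε : 0 < ε) : ∀ᶠ N in Filter.atTop, discretize N n c ∈ SeqChain.supportedOn fun l =>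
      (∀ x ∈ l, x ∈ carrier c) ∧ ∀ x ∈ l, ∀ y ∈ l, dist x y < ε := by
  suffices h : ∀ᶠ N in Filter.atTop, ∀ f ∈ c.support, discretize N n (Finsupp.single f 1) ∈
      SeqChain.supportedOn fun l => (∀ x ∈ l, x ∈ carrier c) ∧ ∀ x ∈ l, ∀ y ∈ l, dist x y < ε from
    h.mono fun N hN => discretize_mem hN
  rw [Filter.eventually_all_finset]
  intro f hf
  obtain ⟨δ, hδ, hfδ⟩ := Metric.uniformContinuous_iff.1
    (CompactSpace.uniformContinuous_of_continuous f.continuous) ε hε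
  have h1 : (0 : ℝ) < ((n + 1 : ℕ) : ℝ)⁻¹ := by positivity
  have h2 : ((n + 1 : ℕ) : ℝ)⁻¹ ≤ 1 := inv_le_one_of_one_le₀ (by simp)
  have h3 := tendsto_pow_atTop_nhds_zero_of_lt_one (r := 1 - ((n + 1 : ℕ) : ℝ)⁻¹)
    (by linarith) (by linarith)
  filter_upwards [h3.eventually_lt_const hδ] with N hN
  rw [discretize_single]
  refine SeqChain.map_mem ?_ (subdivision_vertices_mem n N)
  rintro l ⟨-, h4, h5⟩
  simp only [List.mem_map, forall_exists_index, and_imp, forall_apply_eq_imp_iff₂]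
  refine ⟨fun x hx => ?_, fun x hx y hy => ?_⟩
  · rw [extend, dif_pos (h4 x hx)]
    exact Set.mem_biUnion hf ⟨_, rfl⟩
  · rw [extend, dif_pos (h4 x hx), extend, dif_pos (h4 y hy)]
    exact hfδ ((h5 x hx y hy).trans_lt hN)

lemma eventually_separated {d : ℕ} [NeZero d] {m n : ℕ} {A B : Set (Fin d → ℝ)}
    (hAB : Disjoint A B) {c : SingularChain (Fin d → ℝ) m} {c' : SingularChain (Fin d → ℝ) n}
    (hc : c ∈ within A m) (hc' : c' ∈ within B n) :
    ∀ᶠ N in Filter.atTop, ∀ a ∈ (discretize N m c).support, ∀ b ∈ (discretize N n c').support,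
      Separated direction a b := by
  obtain ⟨ε, hε, h⟩ := Metric.exists_pos_forall_lt_edist (isCompact_carrier c)
    (isCompact_carrier c').isClosed (hAB.mono (carrier_subset hc) (carrier_subset hc'))
  filter_upwards [eventually_discretize_mem c (NNReal.coe_pos.2 hε),
    eventually_discretize_mem c' (NNReal.coe_pos.2 hε)] with N h1 h2 a ha b hb
  refine separated_direction (NNReal.coe_pos.2 hε) (h1 ha).2 (h2 hb).2 fun x hx y hy => ?_
  have := h x ((h1 ha).1 x hx) y ((h2 hb).1 y hy)
  rw [edist_nndist, ENNReal.coe_lt_coe] at this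
  exact this.le

end SingularChain

lemma sum_erase_erase {ι M : Type*} [DecidableEq ι] [AddCommMonoid M] (hM : ∀ x : M, x + x = 0)
    (f : Finset ι → M) (σ : Finset ι) :
    ∑ v ∈ σ, ∑ w ∈ σ.erase v, f ((σ.erase v).erase w) = 0 := by
  rw [Finset.sum_sigma']
  refine Finset.sum_involution (fun p _ => ⟨p.2, p.1⟩) ?_ ?_ ?_ ?_
  · rintro ⟨v, w⟩ -
    dsimp only
    rw [Finset.erase_right_comm]
    exact hM _
  · rintro ⟨v, w⟩ hvw - h
    simp only [Finset.mem_sigma, Finset.mem_erase] at hvw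
    simp only [Sigma.mk.injEq] at h
    exact hvw.2.1 h.1
  · rintro ⟨v, w⟩ hvw
    simp only [Finset.mem_sigma, Finset.mem_erase] at hvw ⊢
    exact ⟨hvw.2.2, Ne.symm hvw.2.1, hvw.1⟩
  · rintro ⟨v, w⟩ -
    rfl

namespace SingularChain

variable {X ι : Type*} [TopologicalSpace X] [DecidableEq ι]

open Classical in
/-- Singular chains indexed by finite sets, filling their boundaries inside given sets. -/
noncomputable def filling (F : Finset ι → Set X) (p : ι → X) :
    ∀ m : ℕ, Finset ι → SingularChain X m
  | 0, σ => ∑ v ∈ σ, point (p v)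
  | m + 1, σ =>
    if h : ∃ y ∈ within (F σ) (m + 1), boundary m y = ∑ v ∈ σ, filling F p m (σ.erase v)
    then h.choose else 0

lemma filling_singleton (F : Finset ι → Set X) (p : ι → X) (v : ι) :
    filling F p 0 {v} = point (p v) := by
  simp [filling]

end SingularChain

namespace SingularChain

variable {X : Type} {ι : Type*} [TopologicalSpace X] [DecidableEq ι]

lemma filling_zero_mem {F : Finset ι → Set X} {p : ι → X} (hp : ∀ v, p v ∈ F {v})
    {σ : Finset ι} (hσ : σ.card = 1) : filling F p 0 σ ∈ within (F σ) 0 := by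
  obtain ⟨v, rfl⟩ := Finset.card_eq_one.1 hσ
  rw [filling_singleton]
  exact point_mem (hp v)

lemma filling_succ {F : Finset ι → Set X} (hmono : Monotone F) {k : ℕ}
    (hpath : ∀ σ, σ.Nonempty → σ.card ≤ k + 1 → IsPathConnected (F σ))
    (hhom : ∀ σ, σ.Nonempty → σ.card ≤ k + 1 → ∀ i, 1 ≤ i → i ≤ k - 1 →
      Subsingleton (SingularHomology (ZMod 2) (F σ) i))
    {p : ι → X} (hp : ∀ v, p v ∈ F {v}) {m : ℕ} (hm : m < k) {σ : Finset ι}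
    (hσ : σ.card = m + 2) :
    filling F p (m + 1) σ ∈ within (F σ) (m + 1) ∧
      boundary m (filling F p (m + 1) σ) = ∑ v ∈ σ, filling F p m (σ.erase v) := by
  have hne : σ.Nonempty := Finset.card_pos.1 (by omega)
  suffices h : ∃ y ∈ within (F σ) (m + 1), boundary m y = ∑ v ∈ σ, filling F p m (σ.erase v) by
    rw [filling, dif_pos h]
    exact h.choose_spec
  induction m generalizing σ with
  | zero =>
    obtain ⟨u, v, huv, rfl⟩ := Finset.card_eq_two.1 hσ
    obtain ⟨y, hy, hy'⟩ := exists_within_boundary_eq_point (hpath _ hne (by omega))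
      (hmono (by simp) (hp v)) (hmono (by simp) (hp u))
    refine ⟨y, hy, ?_⟩
    rw [hy', Finset.sum_pair huv]
    simp [huv.symm, Finset.erase_eq_of_notMem, Finset.erase_insert_eq_erase, huv, filling]
  | succ m ih =>
    have ih' : ∀ v ∈ σ, filling F p (m + 1) (σ.erase v) ∈ within (F (σ.erase v)) (m + 1) ∧
        boundary m (filling F p (m + 1) (σ.erase v)) =
          ∑ w ∈ σ.erase v, filling F p m ((σ.erase v).erase w) := by
      intro v hv
      have hc : (σ.erase v).card = m + 2 := by rw [Finset.card_erase_of_mem hv]; omega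
      have h := ih (by omega) hc (Finset.card_pos.1 (by omega))
      rw [filling, dif_pos h]
      exact h.choose_spec
    refine exists_within_boundary_eq (hhom σ hne (by omega) _ (by omega) (by omega)) ?_ ?_
    · exact Submodule.sum_mem _ fun v hv => fun f hf x =>
        hmono (Finset.erase_subset v σ) ((ih' v hv).1 hf x)
    · rw [map_sum, Finset.sum_congr rfl fun v hv => (ih' v hv).2]
      exact sum_erase_erase (fun x => by ext l; exact CharTwo.add_self_eq_zero _) _ _

end SingularChain

section Pairing

variable {X : Type*}

/-- The bilinear extension to chains of a function of two sequences. -/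
noncomputable def pairing (φ : List X → List X → ZMod 2) (c c' : SeqChain X) : ZMod 2 :=
  Finsupp.linearCombination (ZMod 2) (fun a => Finsupp.linearCombination (ZMod 2) (φ a) c') c

@[simp] lemma pairing_single (φ : List X → List X → ZMod 2) (a b : List X) :
    pairing φ (Finsupp.single a 1) (Finsupp.single b 1) = φ a b := by
  simp [pairing]

lemma pairing_eq_sum (φ : List X → List X → ZMod 2) (c c' : SeqChain X) :
    pairing φ c c' = ∑ a ∈ c.support, ∑ b ∈ c'.support, c a * c' b * φ a b := by
  simp only [pairing, Finsupp.linearCombination_apply, Finsupp.sum, smul_eq_mul, Finset.mul_sum,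
    mul_assoc]

lemma pairing_congr {φ ψ : List X → List X → ZMod 2} {c c' : SeqChain X}
    (h : ∀ a ∈ c.support, ∀ b ∈ c'.support, φ a b = ψ a b) : pairing φ c c' = pairing ψ c c' := by
  rw [pairing_eq_sum, pairing_eq_sum]
  exact Finset.sum_congr rfl fun a ha => Finset.sum_congr rfl fun b hb => by rw [h a ha b hb]

lemma pairing_eq_zero {φ : List X → List X → ZMod 2} {c c' : SeqChain X}
    (h : ∀ a ∈ c.support, ∀ b ∈ c'.support, φ a b = 0) : pairing φ c c' = 0 := by
  rw [pairing_eq_sum]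
  exact Finset.sum_eq_zero fun a ha => Finset.sum_eq_zero fun b hb => by rw [h a ha b hb, mul_zero]

lemma pairing_add (φ ψ : List X → List X → ZMod 2) (c c' : SeqChain X) :
    pairing (fun a b => φ a b + ψ a b) c c' = pairing φ c c' + pairing ψ c c' := by
  simp only [pairing_eq_sum, mul_add, Finset.sum_add_distrib]

lemma pairing_swap (φ : List X → List X → ZMod 2) (c c' : SeqChain X) :
    pairing φ c c' = pairing (fun a b => φ b a) c' c := by
  rw [pairing_eq_sum, pairing_eq_sum, Finset.sum_comm]
  exact Finset.sum_congr rfl fun a _ => Finset.sum_congr rfl fun b _ => by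
    rw [mul_comm (c b)]

lemma pairing_boundary_right (φ : List X → List X → ZMod 2) (c c' : SeqChain X) :
    pairing φ c (SeqChain.boundary c') = pairing (fun a b => coboundary (φ a) b) c c' := by
  simp only [pairing, SeqChain.linearCombination_boundary]

lemma pairing_boundary_left (φ : List X → List X → ZMod 2) (c c' : SeqChain X) :
    pairing φ (SeqChain.boundary c) c' =
      pairing (fun a b => coboundary (fun a' => φ a' b) a) c c' := by
  rw [pairing_swap, pairing_boundary_right, pairing_swap]

lemma pairing_sum_left {κ : Type*} (φ : List X → List X → ZMod 2) (s : Finset κ)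
    (c : κ → SeqChain X) (c' : SeqChain X) :
    pairing φ (∑ i ∈ s, c i) c' = ∑ i ∈ s, pairing φ (c i) c' :=
  map_sum (Finsupp.linearCombination (ZMod 2)
    fun a => Finsupp.linearCombination (ZMod 2) (φ a) c') _ _

lemma pairing_sum_right {κ : Type*} (φ : List X → List X → ZMod 2) (s : Finset κ)
    (c : SeqChain X) (c' : κ → SeqChain X) :
    pairing φ c (∑ i ∈ s, c' i) = ∑ i ∈ s, pairing φ c (c' i) := by
  rw [pairing_swap, pairing_sum_left]
  exact Finset.sum_congr rfl fun i _ => pairing_swap _ _ _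

lemma pairing_linking_add_swap {ι : Type*} [LinearOrder ι] {lab : X × X → ι × Bool}
    {c c' : SeqChain X} (h : ∀ a ∈ c.support, ∀ b ∈ c'.support, Separated lab a b) :
    pairing (linking lab) c c' + pairing (linking lab) c' c =
      pairing (linking lab) (SeqChain.boundary c) c' +
        pairing (linking lab) c (SeqChain.boundary c') +
          pairing (fun a b => if a.length = 1 ∧ b.length = 1 then 1 else 0) c c' := by
  rw [pairing_swap _ c' c, pairing_boundary_left, pairing_boundary_right, ← pairing_add,
    ← pairing_add, ← pairing_add]
  exact pairing_congr fun a ha b hb => linking_add_swap lab a b (h a ha b hb)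

end Pairing

section Form

open SingularChain

variable {ι : Type*} [DecidableEq ι]

/-- The subdivided filling chain attached to a finite set. -/
noncomputable def discreteFilling {X : Type*} [TopologicalSpace X] (F : Finset ι → Set X)
    (p : ι → X) (N : ℕ) (σ : Finset ι) : SeqChain X :=
  if σ = ∅ then Finsupp.single [] 1
  else discretize N (σ.card - 1) (filling F p (σ.card - 1) σ)

lemma discreteFilling_of_card {X : Type*} [TopologicalSpace X] (F : Finset ι → Set X)
    (p : ι → X) (N : ℕ) {σ : Finset ι} {m : ℕ} (h : σ.card = m + 1) :
    discreteFilling F p N σ = discretize N m (filling F p m σ) := by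
  have : σ ≠ ∅ := by rintro rfl; simp at h
  rw [discreteFilling, if_neg this, show σ.card - 1 = m by omega]

lemma discreteFilling_singleton {X : Type*} [TopologicalSpace X] (F : Finset ι → Set X)
    (p : ι → X) (N : ℕ) (v : ι) :
    discreteFilling F p N {v} = Finsupp.single [p v] 1 := by
  rw [discreteFilling_of_card F p N (Finset.card_singleton v), filling_singleton,
    discretize_point]

lemma length_of_mem_discreteFilling {X : Type*} [TopologicalSpace X] {F : Finset ι → Set X}
    {p : ι → X} {N : ℕ} {σ : Finset ι} {l : List X} (hl : l ∈ (discreteFilling F p N σ).support) :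
    l.length = σ.card := by
  rcases σ.eq_empty_or_nonempty with rfl | hσ
  · rw [discreteFilling, if_pos rfl] at hl
    have := Finsupp.support_single_subset hl
    simp_all
  · obtain ⟨m, hm⟩ := Nat.exists_eq_succ_of_ne_zero (Finset.card_pos.2 hσ).ne'
    rw [discreteFilling_of_card F p N hm] at hl
    rw [length_of_mem_discretize hl, hm]

lemma exists_linking_form {d : ℕ} [NeZero d] [Finite ι] {F : Finset ι → Set (Fin d → ℝ)}
    (hmono : Monotone F) (hdisj : ∀ σ τ, Disjoint σ τ → Disjoint (F σ) (F τ)) {k : ℕ}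
    (hpath : ∀ σ, σ.Nonempty → σ.card ≤ k + 1 → IsPathConnected (F σ))
    (hhom : ∀ σ, σ.Nonempty → σ.card ≤ k + 1 → ∀ i, 1 ≤ i → i ≤ k - 1 →
      Subsingleton (SingularHomology (ZMod 2) (F σ) i)) :
    ∃ E : Finset ι → Finset ι → ZMod 2, (∀ τ, E ∅ τ = 0) ∧ (∀ σ, E σ ∅ = 0) ∧
      (∀ σ τ, d + 2 ≤ σ.card + τ.card → E σ τ = 0) ∧
      ∀ σ τ, Disjoint σ τ → σ.Nonempty → τ.Nonempty → σ.card ≤ k + 1 → τ.card ≤ k + 1 →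
        E σ τ + E τ σ = ∑ v ∈ σ, E (σ.erase v) τ + ∑ w ∈ τ, E σ (τ.erase w) +
          if σ.card = 1 ∧ τ.card = 1 then 1 else 0 := by
  choose p hp using fun v : ι => (hpath {v} (Finset.singleton_nonempty v) (by simp)).nonempty
  have hmem : ∀ m ≤ k, ∀ σ : Finset ι, σ.card = m + 1 → filling F p m σ ∈ within (F σ) m := by
    intro m hm σ hσ
    cases m with
    | zero => exact filling_zero_mem hp hσ
    | succ m => exact (filling_succ hmono hpath hhom hp hm hσ).1
  have hbd : ∀ N, ∀ σ : Finset ι, σ.Nonempty → σ.card ≤ k + 1 →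
      SeqChain.boundary (discreteFilling F p N σ) =
        ∑ v ∈ σ, discreteFilling F p N (σ.erase v) := by
    intro N σ hσ hσk
    obtain ⟨m, hm⟩ := Nat.exists_eq_succ_of_ne_zero (Finset.card_pos.2 hσ).ne'
    cases m with
    | zero =>
      obtain ⟨v, rfl⟩ := Finset.card_eq_one.1 hm
      rw [discreteFilling_singleton, SeqChain.boundary_single, Finset.sum_singleton]
      simp [SeqChain.seqBoundary, discreteFilling]
    | succ m =>
      rw [discreteFilling_of_card F p N hm, boundary_discretize,
        (filling_succ hmono hpath hhom hp (by omega) hm).2, map_sum]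
      refine Finset.sum_congr rfl fun v hv => (discreteFilling_of_card F p N ?_).symm
      rw [Finset.card_erase_of_mem hv]
      omega
  have hsep : ∀ᶠ N in Filter.atTop, ∀ q : Finset ι × Finset ι, Disjoint q.1 q.2 → q.1.Nonempty →
      q.2.Nonempty → q.1.card ≤ k + 1 → q.2.card ≤ k + 1 →
        ∀ a ∈ (discreteFilling F p N q.1).support, ∀ b ∈ (discreteFilling F p N q.2).support,
          Separated direction a b := by
    rw [Filter.eventually_all]
    rintro ⟨σ, τ⟩
    by_cases h : Disjoint σ τ ∧ σ.Nonempty ∧ τ.Nonempty ∧ σ.card ≤ k + 1 ∧ τ.card ≤ k + 1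
    · obtain ⟨h1, h2, h3, h4, h5⟩ := h
      obtain ⟨m, hm⟩ := Nat.exists_eq_succ_of_ne_zero (Finset.card_pos.2 h2).ne'
      obtain ⟨n, hn⟩ := Nat.exists_eq_succ_of_ne_zero (Finset.card_pos.2 h3).ne'
      filter_upwards [eventually_separated (hdisj σ τ h1) (hmem m (by omega) σ hm)
        (hmem n (by omega) τ hn)] with N hN _ _ _ _ _
      rw [discreteFilling_of_card F p N hm, discreteFilling_of_card F p N hn]
      exact hN
    · refine Filter.Eventually.of_forall fun N h1 h2 h3 h4 h5 => ?_
      exact absurd ⟨h1, h2, h3, h4, h5⟩ h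
  obtain ⟨N, hN⟩ := hsep.exists
  refine ⟨fun σ τ => pairing (linking direction) (discreteFilling F p N σ)
    (discreteFilling F p N τ), fun τ => ?_, fun σ => ?_, fun σ τ h => ?_, ?_⟩
  · refine pairing_eq_zero fun a ha b _ => ?_
    obtain rfl := List.length_eq_zero_iff.1 (length_of_mem_discreteFilling ha)
    simp [linking]
  · refine pairing_eq_zero fun a _ b hb => ?_
    obtain rfl := List.length_eq_zero_iff.1 (length_of_mem_discreteFilling hb)
    simp [linking]
  · refine pairing_eq_zero fun a ha b hb => linking_eq_zero _ _ _ ?_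
    rw [length_of_mem_discreteFilling ha, length_of_mem_discreteFilling hb, Fintype.card_fin]
    omega
  · intro σ τ hστ hσ hτ hσk hτk
    rw [pairing_linking_add_swap (hN (σ, τ) hστ hσ hτ hσk hτk), hbd N σ hσ hσk, hbd N τ hτ hτk,
      pairing_sum_left, pairing_sum_right]
    congr 1
    split_ifs with h
    · obtain ⟨v, rfl⟩ := Finset.card_eq_one.1 h.1
      obtain ⟨w, rfl⟩ := Finset.card_eq_one.1 h.2
      simp [discreteFilling_singleton]
    · refine pairing_eq_zero fun a ha b hb => ?_
      rw [length_of_mem_discreteFilling ha, length_of_mem_discreteFilling hb, if_neg h]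

end Form

section PairSum

variable {ι M : Type*} [DecidableEq ι] [AddCommMonoid M]

lemma sum_powersetCard_insert {U : Finset ι} {b : ι} (hb : b ∉ U) (m : ℕ) (g : Finset ι → M) :
    ∑ σ ∈ (insert b U).powersetCard (m + 1), g σ =
      ∑ σ ∈ U.powersetCard (m + 1), g σ + ∑ ρ ∈ U.powersetCard m, g (insert b ρ) := by
  rw [Finset.powersetCard_succ_insert hb, Finset.sum_union, Finset.sum_image]
  · intro ρ hρ ρ' hρ' h
    have h1 : b ∉ ρ := fun h => hb ((Finset.mem_powersetCard.1 hρ).1 h)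
    have h2 : b ∉ ρ' := fun h => hb ((Finset.mem_powersetCard.1 hρ').1 h)
    rw [← Finset.erase_insert h1, h, Finset.erase_insert h2]
  · rw [Finset.disjoint_left]
    intro σ hσ hσ'
    obtain ⟨ρ, -, rfl⟩ := Finset.mem_image.1 hσ'
    exact hb ((Finset.mem_powersetCard.1 hσ).1 (Finset.mem_insert_self b ρ))

lemma sum_powersetCard_erase (U : Finset ι) (m : ℕ) (g : Finset ι → M) :
    ∑ σ ∈ U.powersetCard (m + 1), ∑ v ∈ σ, g (σ.erase v) =
      (U.card - m) • ∑ ρ ∈ U.powersetCard m, g ρ := by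
  have h : ∀ ρ ∈ U.powersetCard m, ∑ v ∈ U \ ρ, g ρ = (U.card - m) • g ρ := by
    intro ρ hρ
    rw [Finset.mem_powersetCard] at hρ
    rw [Finset.sum_const, Finset.card_sdiff_of_subset hρ.1, hρ.2]
  rw [Finset.smul_sum, ← Finset.sum_congr rfl h, Finset.sum_sigma', Finset.sum_sigma']
  refine Finset.sum_bij' (fun p _ => ⟨p.1.erase p.2, p.2⟩) (fun p _ => ⟨insert p.2 p.1, p.2⟩)
    ?_ ?_ ?_ ?_ ?_
  · rintro ⟨σ, v⟩ h
    simp only [Finset.mem_sigma, Finset.mem_powersetCard, Finset.mem_sdiff] at h ⊢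
    obtain ⟨⟨h1, h2⟩, h3⟩ := h
    refine ⟨⟨(Finset.erase_subset _ _).trans h1, ?_⟩, h1 h3, Finset.notMem_erase _ _⟩
    rw [Finset.card_erase_of_mem h3, h2, Nat.add_sub_cancel]
  · rintro ⟨ρ, v⟩ h
    simp only [Finset.mem_sigma, Finset.mem_powersetCard, Finset.mem_sdiff] at h ⊢
    obtain ⟨⟨h1, h2⟩, h3, h4⟩ := h
    exact ⟨⟨Finset.insert_subset h3 h1, by rw [Finset.card_insert_of_notMem h4, h2]⟩,
      Finset.mem_insert_self _ _⟩
  · rintro ⟨σ, v⟩ h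
    simp only [Finset.mem_sigma] at h
    simp [Finset.insert_erase h.2]
  · rintro ⟨ρ, v⟩ h
    simp only [Finset.mem_sigma, Finset.mem_sdiff] at h
    simp [Finset.erase_insert h.2.2]
  · rintro ⟨σ, v⟩ h
    rfl

/-- The sum over the pairs of disjoint subsets of given cardinalities. -/
def pairSum (m n : ℕ) (W : Finset ι) (G : Finset ι → Finset ι → M) : M :=
  ∑ σ ∈ W.powersetCard m, ∑ τ ∈ (W \ σ).powersetCard n, G σ τ

lemma pairSum_congr {m n : ℕ} {W : Finset ι} {G H : Finset ι → Finset ι → M}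
    (h : ∀ σ τ, σ ⊆ W → τ ⊆ W → Disjoint σ τ → σ.card = m → τ.card = n → G σ τ = H σ τ) :
    pairSum m n W G = pairSum m n W H := by
  refine Finset.sum_congr rfl fun σ hσ => Finset.sum_congr rfl fun τ hτ => ?_
  rw [Finset.mem_powersetCard] at hσ hτ
  rw [Finset.subset_sdiff] at hτ
  exact h σ τ hσ.1 hτ.1.1 hτ.1.2.symm hσ.2 hτ.2

lemma pairSum_zero (m n : ℕ) (W : Finset ι) : pairSum m n W (fun _ _ => (0 : M)) = 0 := by
  simp [pairSum]

lemma pairSum_add (m n : ℕ) (W : Finset ι) (G H : Finset ι → Finset ι → M) :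
    pairSum m n W (fun σ τ => G σ τ + H σ τ) = pairSum m n W G + pairSum m n W H := by
  simp only [pairSum, Finset.sum_add_distrib]

lemma pairSum_swap (m n : ℕ) (W : Finset ι) (G : Finset ι → Finset ι → M) :
    pairSum m n W G = pairSum n m W fun σ τ => G τ σ := by
  refine Finset.sum_comm' fun σ τ => ?_
  simp only [Finset.mem_powersetCard, Finset.subset_sdiff, disjoint_comm (a := τ)]
  tauto

lemma pairSum_erase_left (m n : ℕ) (W : Finset ι) (G : Finset ι → Finset ι → M) :
    pairSum (m + 1) n W (fun σ τ => ∑ v ∈ σ, G (σ.erase v) τ) =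
      (W.card - n - m) • pairSum m n W G := by
  rw [pairSum_swap, pairSum_swap m, pairSum, pairSum, Finset.smul_sum]
  refine Finset.sum_congr rfl fun τ hτ => ?_
  rw [Finset.mem_powersetCard] at hτ
  rw [sum_powersetCard_erase (W \ τ) m fun ρ => G ρ τ, Finset.card_sdiff_of_subset hτ.1, hτ.2]

lemma pairSum_erase_right (m n : ℕ) (W : Finset ι) (G : Finset ι → Finset ι → M) :
    pairSum m (n + 1) W (fun σ τ => ∑ w ∈ τ, G σ (τ.erase w)) =
      (W.card - m - n) • pairSum m n W G := by
  rw [pairSum_swap, pairSum_erase_left n m W fun τ σ => G σ τ, pairSum_swap m]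

lemma pairSum_insert {W : Finset ι} {b : ι} (hb : b ∉ W) (m n : ℕ)
    (G : Finset ι → Finset ι → M) :
    pairSum (m + 1) (n + 1) (insert b W) G =
      pairSum (m + 1) (n + 1) W G + pairSum (m + 1) n W (fun σ τ => G σ (insert b τ)) +
        pairSum m (n + 1) W (fun σ τ => G (insert b σ) τ) := by
  simp only [pairSum]
  rw [sum_powersetCard_insert hb, ← Finset.sum_add_distrib]
  congr 1
  · refine Finset.sum_congr rfl fun σ hσ => ?_
    have h : b ∉ σ := fun h => hb ((Finset.mem_powersetCard.1 hσ).1 h)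
    rw [Finset.insert_sdiff_of_notMem _ h, sum_powersetCard_insert (by simp [hb])]
  · refine Finset.sum_congr rfl fun σ hσ => ?_
    rw [Finset.insert_sdiff_insert, Finset.sdiff_insert_of_notMem hb]

lemma pairSum_eq_zero_of_card {m n : ℕ} {W : Finset ι} (h : W.card < m + n)
    (G : Finset ι → Finset ι → M) : pairSum m n W G = 0 := by
  refine (pairSum_congr fun σ τ h1 h2 h3 h4 h5 => ?_).trans (pairSum_zero m n W)
  have := Finset.card_le_card (Finset.union_subset h1 h2)
  rw [Finset.card_union_of_disjoint h3] at this
  omega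

end PairSum

section Parity

variable {ι : Type*} [DecidableEq ι] {E : Finset ι → Finset ι → ZMod 2} {k : ℕ}

/-- The relation satisfied by linking forms. -/
def LinkingRelation (E : Finset ι → Finset ι → ZMod 2) (k : ℕ) : Prop :=
  ∀ σ τ, Disjoint σ τ → σ.Nonempty → τ.Nonempty → σ.card ≤ k + 1 → τ.card ≤ k + 1 →
    E σ τ + E τ σ = ∑ v ∈ σ, E (σ.erase v) τ + ∑ w ∈ τ, E σ (τ.erase w) +
      if σ.card = 1 ∧ τ.card = 1 then 1 else 0

lemma LinkingRelation.pairSum_cone (hE : LinkingRelation E k) {W : Finset ι} {a : ι} (ha : a ∉ W)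
    {m n : ℕ} (hm : m + 1 ≤ k) (hn : n ≤ k) :
    pairSum (m + 1) (n + 1) W (fun σ τ => E (insert a σ) τ + E τ (insert a σ)) =
      pairSum (m + 1) (n + 1) W E +
        (W.card - m - n - 1) • (pairSum m (n + 1) W (fun σ τ => E (insert a σ) τ) +
          pairSum (m + 1) n W (fun σ τ => E (insert a σ) τ)) := by
  have h1 := pairSum_erase_left m (n + 1) W fun σ τ => E (insert a σ) τ
  have h2 := pairSum_erase_right (m + 1) n W fun σ τ => E (insert a σ) τ
  rw [smul_add, show W.card - m - n - 1 = W.card - (n + 1) - m by omega, ← h1,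
    show W.card - (n + 1) - m = W.card - (m + 1) - n by omega, ← h2, ← pairSum_add, ← pairSum_add]
  refine pairSum_congr fun σ τ hσ hτ hd hσm hτn => ?_
  have h3 : a ∉ σ := fun h => ha (hσ h)
  have h4 : a ∉ τ := fun h => ha (hτ h)
  have h5 : (insert a σ).card = m + 2 := by rw [Finset.card_insert_of_notMem h3, hσm]
  rw [hE _ _ (Finset.disjoint_insert_left.2 ⟨h4, hd⟩) (Finset.insert_nonempty _ _)
    (Finset.card_pos.1 (by omega)) (by omega) (by omega), if_neg (by omega), add_zero,
    Finset.sum_insert h3, Finset.erase_insert h3, add_assoc]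
  congr 2
  refine Finset.sum_congr rfl fun v hv => ?_
  rw [Finset.erase_insert_of_ne]
  rintro rfl
  exact h3 hv

lemma LinkingRelation.pairSum_cone_eq (hE : LinkingRelation E k) {W : Finset ι} {b : ι}
    (hb : b ∉ W) {m : ℕ} (hm : m + 1 ≤ k) (hW : W.card = 2 * m + 3) :
    pairSum (m + 1) (m + 1) W (fun σ τ => E (insert b σ) τ + E τ (insert b σ)) =
      pairSum (m + 1) (m + 1) W E := by
  rw [hE.pairSum_cone hb hm (by omega), show W.card - m - m - 1 = 2 by omega, two_smul,
    CharTwo.add_self_eq_zero, add_zero]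

lemma pairSum_symm_insert {W : Finset ι} {b : ι} (hb : b ∉ W) (m : ℕ) :
    pairSum (m + 1) (m + 1) (insert b W) E = pairSum (m + 1) (m + 1) W E +
      pairSum m (m + 1) W (fun σ τ => E (insert b σ) τ + E τ (insert b σ)) := by
  rw [pairSum_insert hb, pairSum_add, pairSum_swap (m + 1) m, add_assoc]
  congr 1
  exact add_comm _ _

lemma LinkingRelation.pairSum_eq_one (hE : LinkingRelation E k) (h0 : ∀ τ, E ∅ τ = 0)
    (h0' : ∀ σ, E σ ∅ = 0) {m : ℕ} (hm : m ≤ k) {W : Finset ι} (hW : W.card = 2 * m + 3) :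
    pairSum (m + 1) (m + 1) W E = 1 := by
  induction m generalizing W with
  | zero =>
    have h1 : ∀ v w, v ≠ w → E {v} {w} + E {w} {v} = 1 := by
      intro v w h
      rw [hE _ _ (by simpa using h) (by simp) (by simp) (by simp) (by simp)]
      simp [h0, h0']
    obtain ⟨x, y, z, hxy, hxz, hyz, rfl⟩ := Finset.card_eq_three.1 hW
    rw [pairSum_symm_insert (by simp [hxy, hxz]), pairSum_symm_insert (by simpa using hyz),
      pairSum_eq_zero_of_card (by simp), zero_add]
    simp only [pairSum, Finset.powersetCard_zero, Finset.sum_singleton, zero_add,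
      Finset.powersetCard_one, Finset.sdiff_empty, Finset.sum_map, Finset.sum_pair hyz,
      insert_empty_eq, Function.Embedding.coeFn_mk]
    rw [h1 y z hyz, h1 x y hxy, h1 x z hxz]
    rfl
  | succ m ih =>
    obtain ⟨a, V, ha, rfl, hV⟩ := Finset.card_eq_succ.1 (show W.card = (2 * m + 4) + 1 by omega)
    obtain ⟨b, U, hb, rfl, hU⟩ := Finset.card_eq_succ.1 (show V.card = (2 * m + 3) + 1 by omega)
    rw [← ih (by omega) hU, ← hE.pairSum_cone_eq hb hm hU, pairSum_symm_insert ha,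
      hE.pairSum_cone ha hm hm, show (insert b U).card - m - (m + 1) - 1 = 2 by omega, two_smul,
      CharTwo.add_self_eq_zero, add_zero, pairSum_symm_insert hb, pairSum_insert hb,
      pairSum_eq_zero_of_card (m := m + 1 + 1) (n := m + 1 + 1) (by omega), zero_add,
      hE.pairSum_cone hb hm hm, show U.card - m - (m + 1) - 1 = 1 by omega, one_smul,
      pairSum_add, pairSum_swap (m + 1) (m + 1) U fun σ τ => E τ (insert b σ)]
    linear_combination (pairSum (m + 1) (m + 1 + 1) U E +
      pairSum m (m + 1 + 1) U fun σ τ => E (insert b σ) τ) * CharTwo.two_eq_zero (R := ZMod 2)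

theorem LinkingRelation.false (hE : LinkingRelation E k) (h0 : ∀ τ, E ∅ τ = 0)
    (h0' : ∀ σ, E σ ∅ = 0) {d : ℕ} (hd : 1 ≤ d) (hk : k = (d + 1) / 2)
    (hE0 : ∀ σ τ, d + 2 ≤ σ.card + τ.card → E σ τ = 0) {V : Finset ι}
    (hV : V.card = d + 3) : False := by
  refine zero_ne_one (α := ZMod 2) ?_
  rcases Nat.even_or_odd d with h | h
  · obtain ⟨r, rfl⟩ := h
    rw [← hE.pairSum_eq_one h0 h0' le_rfl (W := V) (by omega)]
    refine ((pairSum_congr fun σ τ _ _ _ hσ hτ => ?_).trans (pairSum_zero _ _ _)).symm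
    exact hE0 _ _ (by omega)
  · obtain ⟨r, rfl⟩ := h
    obtain ⟨b, W, hb, rfl, hW⟩ := Finset.card_eq_succ.1 hV
    obtain rfl : k = r + 1 := by omega
    rw [← hE.pairSum_eq_one h0 h0' (m := r) (by omega) (W := W) (by omega),
      ← hE.pairSum_cone_eq hb le_rfl (by omega)]
    refine ((pairSum_congr fun σ τ hσW _ _ hσ hτ => ?_).trans (pairSum_zero _ _ _)).symm
    have : (insert b σ).card = r + 2 := by
      rw [Finset.card_insert_of_notMem fun h => hb (hσW h), hσ]
    rw [hE0 _ _ (by omega), hE0 _ _ (by omega), add_zero]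

end Parity

end VanKampenFlores

/-- **Helly-type theorem from the homological van Kampen–Flores theorem**
(Goaoc, Paták, Patáková, Tancer, Wagner). Let `d ≥ 1` and let `ℱ` be a finite family of
subsets of `ℝ^d` such that the intersection of every nonempty subfamily is either empty,
or path-connected with vanishing `ℤ₂` singular homology in all degrees
`1 ≤ i ≤ ⌈d/2⌉ − 1`. Then `⋂ℱ = ∅` iff some subfamily with at most `d + 2` members has
empty intersection. -/
theorem helly_from_homological_van_kampen_flores
    (d : ℕ) (hd : 1 ≤ d)
    (ℱ : Finset (Set (Fin d → ℝ)))
    (hgood : ∀ ℱ' : Finset (Set (Fin d → ℝ)), ℱ' ⊆ ℱ → ℱ'.Nonempty →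
      ⋂₀ (ℱ' : Set (Set (Fin d → ℝ))) = ∅ ∨
        (IsPathConnected (⋂₀ (ℱ' : Set (Set (Fin d → ℝ)))) ∧
          ∀ i : ℕ, 1 ≤ i → i ≤ (d + 1) / 2 - 1 →
            Subsingleton (SingularHomology (ZMod 2)
              ↥(⋂₀ (ℱ' : Set (Set (Fin d → ℝ)))) i))) :
    ⋂₀ (ℱ : Set (Set (Fin d → ℝ))) = ∅ ↔
      ∃ 𝒢 ⊆ ℱ, 𝒢.card ≤ d + 2 ∧ ⋂₀ (𝒢 : Set (Set (Fin d → ℝ))) = ∅ := by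
  classical
  constructor
  swap
  · rintro ⟨𝒢, h1, -, h2⟩
    exact Set.subset_eq_empty (Set.sInter_subset_sInter (Finset.coe_subset.2 h1)) h2
  intro hempty
  have : NeZero d := ⟨by omega⟩
  obtain ⟨𝒢, h𝒢, hmin⟩ := exists_minimal_le_of_wellFoundedLT
    (fun 𝒢 : Finset (Set (Fin d → ℝ)) => ⋂₀ (𝒢 : Set (Set (Fin d → ℝ))) = ∅) ℱ hempty
  refine ⟨𝒢, h𝒢, ?_, hmin.prop⟩
  by_contra! hcard
  let S : Finset 𝒢 → Finset (Set (Fin d → ℝ)) := fun σ => 𝒢 \ σ.map ⟨_, Subtype.val_injective⟩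
  have hS : ∀ σ, σ.Nonempty → σ.card ≤ (d + 1) / 2 + 1 →
      IsPathConnected (⋂₀ (S σ : Set (Set (Fin d → ℝ)))) ∧
        ∀ i : ℕ, 1 ≤ i → i ≤ (d + 1) / 2 - 1 → Subsingleton (SingularHomology (ZMod 2)
          ↥(⋂₀ (S σ : Set (Set (Fin d → ℝ)))) i) := by
    intro σ hσ hσd
    refine (hgood (S σ) (Finset.sdiff_subset.trans h𝒢) ?_).resolve_left fun h => ?_
    · rw [← Finset.card_pos, Finset.card_sdiff_of_subset, Finset.card_map]
      · omega
      · intro x hx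
        obtain ⟨y, -, rfl⟩ := Finset.mem_map.1 hx
        exact y.2
    · obtain ⟨v, hv⟩ := hσ
      have := hmin.le_of_le h Finset.sdiff_subset v.2
      exact (Finset.mem_sdiff.1 this).2 (Finset.mem_map.2 ⟨v, hv, rfl⟩)
  have hdisj : ∀ σ τ, Disjoint σ τ → Disjoint (⋂₀ (S σ : Set (Set (Fin d → ℝ))))
      (⋂₀ (S τ : Set (Set (Fin d → ℝ)))) := by
    intro σ τ h
    rw [Set.disjoint_iff_inter_eq_empty, ← Set.sInter_union, ← Finset.coe_union,
      ← Finset.sdiff_inter_distrib_right, ← Finset.map_inter, Finset.disjoint_iff_inter_eq_empty.1 h,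
      Finset.map_empty, Finset.sdiff_empty, hmin.prop]
  obtain ⟨E, h0, h0', hE0, hE⟩ := VanKampenFlores.exists_linking_form
    (F := fun σ => ⋂₀ (S σ : Set (Set (Fin d → ℝ)))) (k := (d + 1) / 2)
    (fun σ τ h => Set.sInter_subset_sInter (Finset.coe_subset.2
      (Finset.sdiff_subset_sdiff le_rfl (Finset.map_subset_map.2 h))))
    hdisj (fun σ h1 h2 => (hS σ h1 h2).1) (fun σ h1 h2 => (hS σ h1 h2).2)
  obtain ⟨V, -, hV⟩ := Finset.exists_subset_card_eq (s := (Finset.univ : Finset 𝒢))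
    (n := d + 3) (by rw [Finset.card_univ, Fintype.card_coe]; omega)
  exact VanKampenFlores.LinkingRelation.false hE h0 h0' hd rfl hE0 hV
end
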